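/- arXiv:2104.04960 — 6 statements merged into one kernel-verified Lean document; each statement's English description precedes it below -/
import Mathlib

section
/- Let I be a compact interval, p a stochastic kernel on I, and L the associated Markov operator. For any ρ ∈ BV(I), if C := esssup_{x ∈ supp ρ} |p(x,·)|_TV < ∞ (where supp ρ is the essential support of ρ), then |Lρ|_TV ≤ C·‖ρ‖_{L¹} and ‖Lρ‖_BV ≤ (C+1)·‖ρ‖_{L¹}. -/
open MeasureTheory Set Filter Topology
open scoped ENNReal NNReal

/-- The increments of a parametric integral are controlled by the variation of its integrand. -/
theorem eVariationOn_integral_le {α E : Type*} [MeasurableSpace α] [NormedAddCommGroup E]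
    [NormedSpace ℝ E] {μ : Measure α} {f : α → ℝ → E} {s : Set ℝ}
    (hf : ∀ y ∈ s, Integrable (fun x => f x y) μ) :
    eVariationOn (fun y => ∫ x, f x y ∂μ) s ≤ ∫⁻ x, eVariationOn (f x) s ∂μ := by
  refine iSup_le fun ⟨n, u, hu, hus⟩ => ?_
  calc ∑ i ∈ Finset.range n, edist (∫ x, f x (u (i + 1)) ∂μ) (∫ x, f x (u i) ∂μ)
      ≤ ∑ i ∈ Finset.range n, ∫⁻ x, edist (f x (u (i + 1))) (f x (u i)) ∂μ := by
        refine Finset.sum_le_sum fun i _ => ?_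
        rw [edist_eq_enorm_sub, ← integral_sub (hf _ (hus _)) (hf _ (hus _))]
        simp only [edist_eq_enorm_sub]
        exact enorm_integral_le_lintegral_enorm _
    _ = ∫⁻ x, ∑ i ∈ Finset.range n, edist (f x (u (i + 1))) (f x (u i)) ∂μ := by
        refine (lintegral_finsetSum' _ fun i _ => ?_).symm
        simp only [edist_eq_enorm_sub]
        exact ((hf _ (hus _)).sub (hf _ (hus _))).aestronglyMeasurable.enorm
    _ ≤ ∫⁻ x, eVariationOn (f x) s ∂μ :=
        lintegral_mono fun x => eVariationOn.sum_le hu hus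

/-- A function of finite variation on `[a, b]` exceeds its mean by at most its variation. -/
theorem le_average_add_of_eVariationOn_le {a b : ℝ} (hab : a < b) {f : ℝ → ℝ}
    (hf : IntegrableOn f (Icc a b)) {C : ℝ≥0∞} (hC : C ≠ ⊤)
    (hv : eVariationOn f (Icc a b) ≤ C) {y : ℝ} (hy : y ∈ Icc a b) :
    f y ≤ (∫ z in Icc a b, f z) / (b - a) + C.toReal := by
  have hdiff : ∀ z ∈ Icc a b, f y - C.toReal ≤ f z := by
    intro z hz
    have h := (eVariationOn.edist_le f hy hz).trans hv
    have h' := ENNReal.toReal_mono hC h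
    rw [edist_dist, ENNReal.toReal_ofReal dist_nonneg, Real.dist_eq] at h'
    linarith [le_abs_self (f y - f z)]
  have hint := setIntegral_mono_on (μ := volume) (f := fun _ => f y - C.toReal) (by simp) hf
    measurableSet_Icc hdiff
  rw [setIntegral_const, measureReal_def, Real.volume_Icc,
    ENNReal.toReal_ofReal (by linarith), smul_eq_mul] at hint
  have : f y - C.toReal ≤ (∫ z in Icc a b, f z) / (b - a) := by
    rw [le_div_iff₀ (by linarith)]
    linarith
  linarith

/-- A sub-Markov kernel contracts the `L¹` norm. -/
theorem lintegral_enorm_integral_mul_le {α β : Type*} [MeasurableSpace α] [MeasurableSpace β]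
    {μ : Measure α} {ν : Measure β} [SFinite μ] [SFinite ν] {p : α → β → ℝ}
    (hp : Measurable (Function.uncurry p)) (hmass : ∀ᵐ x ∂μ, ∫⁻ y, ‖p x y‖ₑ ∂ν ≤ 1)
    {ρ : α → ℝ} (hρ : AEStronglyMeasurable ρ μ) :
    ∫⁻ y, ‖∫ x, p x y * ρ x ∂μ‖ₑ ∂ν ≤ ∫⁻ x, ‖ρ x‖ₑ ∂μ := by
  calc ∫⁻ y, ‖∫ x, p x y * ρ x ∂μ‖ₑ ∂ν
      ≤ ∫⁻ y, ∫⁻ x, ‖p x y‖ₑ * ‖ρ x‖ₑ ∂μ ∂ν := by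
        refine lintegral_mono fun y => (enorm_integral_le_lintegral_enorm _).trans_eq ?_
        simp only [enorm_mul]
    _ = ∫⁻ x, ∫⁻ y, ‖p x y‖ₑ * ‖ρ x‖ₑ ∂ν ∂μ := by
        refine (lintegral_lintegral_swap ?_).symm
        exact hp.enorm.aemeasurable.mul hρ.enorm.comp_fst
    _ = ∫⁻ x, (∫⁻ y, ‖p x y‖ₑ ∂ν) * ‖ρ x‖ₑ ∂μ := by
        refine lintegral_congr fun x => ?_
        exact lintegral_mul_const _ (hp.comp measurable_prodMk_left).enorm
    _ ≤ ∫⁻ x, ‖ρ x‖ₑ ∂μ := by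
        refine lintegral_mono_ae (hmass.mono fun x hx => ?_)
        exact (mul_le_mul_left hx _).trans_eq (one_mul _)

/-- Scaling a real function scales its variation. -/
theorem eVariationOn_mul_const_le (f : ℝ → ℝ) (s : Set ℝ) (c : ℝ) :
    eVariationOn (fun y => f y * c) s ≤ eVariationOn f s * ‖c‖ₑ := by
  refine iSup_le fun ⟨n, u, hu, hus⟩ => ?_
  simp only [edist_eq_enorm_sub, ← sub_mul, enorm_mul, ← Finset.sum_mul]
  gcongr
  simpa only [edist_eq_enorm_sub] using eVariationOn.sum_le (f := f) hu hus

/-- Let `I = [a,b]` be a compact interval, `p` a stochastic kernel on `I`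
(measurable, nonnegative, with `∫_I p(x,y) dy = 1` for every `x ∈ I`), and `L` the associated
Markov operator `(Lρ)(y) = ∫_I p(x,y) ρ(x) dx`.  For any `ρ ∈ BV(I)`, if
`C := esssup_{x ∈ supp ρ} |p(x,·)|_TV < ∞`, then `|Lρ|_TV ≤ C·‖ρ‖₁` and
`‖Lρ‖_BV ≤ (C+1)·‖ρ‖₁`. -/
theorem markov_operator_tv_bound
    (a b : ℝ) (hab : a ≤ b)
    (p : ℝ → ℝ → ℝ)
    (hp_meas : Measurable (Function.uncurry p))
    (hp_nonneg : ∀ x y, 0 ≤ p x y)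
    (hp_prob : ∀ x ∈ Set.Icc a b, ∫ y in Set.Icc a b, p x y = 1)
    (ρ : ℝ → ℝ)
    (hρ_int : IntegrableOn ρ (Set.Icc a b))
    (hρ_bv : BoundedVariationOn ρ (Set.Icc a b))
    (C : ℝ≥0∞)
    (hC : C = essSup (fun x => eVariationOn (p x) (Set.Icc a b))
      ((volume.restrict (Set.Icc a b)).restrict (Function.support ρ)))
    (hC_fin : C ≠ ⊤) :
    eVariationOn (fun y => ∫ x in Set.Icc a b, p x y * ρ x) (Set.Icc a b)
        ≤ C * ∫⁻ x in Set.Icc a b, ENNReal.ofReal |ρ x| ∧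
    eVariationOn (fun y => ∫ x in Set.Icc a b, p x y * ρ x) (Set.Icc a b)
        + ∫⁻ y in Set.Icc a b, ENNReal.ofReal |∫ x in Set.Icc a b, p x y * ρ x|
        ≤ (C + 1) * ∫⁻ x in Set.Icc a b, ENNReal.ofReal |ρ x| := by
  have hab' : a < b := by
    refine hab.lt_of_ne fun h => ?_
    have := hp_prob a ⟨le_rfl, hab⟩
    simp [← h] at this
  have hp_int : ∀ x ∈ Icc a b, IntegrableOn (p x) (Icc a b) := fun x hx =>
    Integrable.of_integral_ne_zero (by rw [hp_prob x hx]; exact one_ne_zero)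
  have hae : ∀ᵐ x ∂volume.restrict (Icc a b), ρ x ≠ 0 → eVariationOn (p x) (Icc a b) ≤ C := by
    have hsupp : NullMeasurableSet (Function.support ρ) (volume.restrict (Icc a b)) :=
      hρ_int.aestronglyMeasurable.nullMeasurableSet_support
    rw [hC]
    exact (ae_restrict_iff'₀ hsupp).1 (ENNReal.ae_le_essSup _)
  have hmem : ∀ᵐ x ∂volume.restrict (Icc a b), x ∈ Icc a b := ae_restrict_mem measurableSet_Icc
  have hLint : ∀ y ∈ Icc a b, IntegrableOn (fun x => p x y * ρ x) (Icc a b) := by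
    intro y hy
    refine Integrable.mono' (hρ_int.norm.const_mul (1 / (b - a) + C.toReal))
      ((hp_meas.comp measurable_prodMk_right).aestronglyMeasurable.mul
        hρ_int.aestronglyMeasurable) ?_
    filter_upwards [hae, hmem] with x hx hxI
    by_cases h0 : ρ x = 0
    · simp [h0]
    rw [norm_mul, Real.norm_of_nonneg (hp_nonneg x y)]
    gcongr
    simpa only [hp_prob x hxI] using
      le_average_add_of_eVariationOn_le hab' (hp_int x hxI) hC_fin (hx h0) hy
  simp only [← Real.enorm_eq_ofReal_abs]
  have hTV : eVariationOn (fun y => ∫ x in Icc a b, p x y * ρ x) (Icc a b)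
      ≤ C * ∫⁻ x in Icc a b, ‖ρ x‖ₑ := by
    rw [← lintegral_const_mul' _ _ hC_fin]
    refine (eVariationOn_integral_le hLint).trans (lintegral_mono_ae ?_)
    filter_upwards [hae] with x hx
    refine (eVariationOn_mul_const_le _ _ _).trans ?_
    by_cases h0 : ρ x = 0
    · simp [h0]
    gcongr
    exact hx h0
  refine ⟨hTV, ?_⟩
  rw [add_mul, one_mul]
  refine add_le_add hTV
    (lintegral_enorm_integral_mul_le hp_meas ?_ hρ_int.aestronglyMeasurable)
  filter_upwards [hmem] with x hxI
  rw [← ofReal_integral_norm_eq_lintegral_enorm (hp_int x hxI)]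
  simp only [Real.norm_of_nonneg (hp_nonneg x _), hp_prob x hxI, ENNReal.ofReal_one, le_refl]
end

section
/- Let I be a compact interval and p a stochastic kernel on I with uniformly bounded variations, i.e. C := esssup_{x ∈ I} |p(x,·)|_TV < ∞, and let L be the associated Markov operator. Then for every ρ ∈ L¹(I) and every integer n ≥ 1, ‖Lⁿρ‖_BV ≤ (C+1)·‖ρ‖_{L¹}. -/
open MeasureTheory Set Filter Topology
open scoped ENNReal NNReal

/-- A nonnegative function of finite variation on `[a, b]` is pointwise bounded in terms of its
variation and its integral. -/
lemma mul_le_integral_add_variation {a b : ℝ} (hab : a ≤ b) {f : ℝ → ℝ}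
    (hf : IntegrableOn f (Icc a b)) {C : ℝ≥0∞} (hC : C ≠ ⊤)
    (hv : eVariationOn f (Icc a b) ≤ C) {y : ℝ} (hy : y ∈ Icc a b) :
    (b - a) * f y ≤ (∫ z in Icc a b, f z) + (b - a) * C.toReal := by
  have hc : ∀ c : ℝ, ∫ _ in Icc a b, c = (b - a) * c := fun c => by
    simp [Real.volume_real_Icc_of_le hab]
  have hcint : ∀ c : ℝ, IntegrableOn (fun _ : ℝ => c) (Icc a b) := fun c => by
    simp [integrableOn_const_iff]
  rw [← hc, ← hc, ← integral_add hf (hcint _)]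
  refine setIntegral_mono_on (hcint _) (hf.add (hcint _)) measurableSet_Icc fun z hz => ?_
  have h := (eVariationOn.edist_le f hy hz).trans hv
  rw [edist_dist] at h
  have h' := (ENNReal.ofReal_le_iff_le_toReal hC).1 h
  rw [Real.dist_eq] at h'
  linarith [le_abs_self (f y - f z)]

/-- If almost every kernel section has variation at most `C` on `s`, the associated integral
operator maps `f` to a function of variation at most `C * ‖f‖₁` on `s`. -/
lemma eVariationOn_integral_kernel_le {μ : Measure ℝ} {s : Set ℝ} {p : ℝ → ℝ → ℝ}
    (hp : Measurable (Function.uncurry p)) {C : ℝ≥0∞}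
    (hv : ∀ᵐ x ∂μ, eVariationOn (p x) s ≤ C) {f : ℝ → ℝ} (hf : Integrable f μ)
    (hpf : ∀ y ∈ s, Integrable (fun x => p x y * f x) μ) :
    eVariationOn (fun y => ∫ x, p x y * f x ∂μ) s ≤ C * ∫⁻ x, ENNReal.ofReal |f x| ∂μ := by
  have hpy : ∀ y, Measurable fun x => p x y := fun y =>
    hp.comp (measurable_id.prodMk measurable_const)
  have hfm : AEMeasurable (fun x => ENNReal.ofReal |f x|) μ :=
    hf.aestronglyMeasurable.aemeasurable.abs.ennreal_ofReal
  refine iSup_le fun ⟨n, u, hu, hus⟩ => ?_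
  have key : ∀ i, edist (∫ x, p x (u (i + 1)) * f x ∂μ) (∫ x, p x (u i) * f x ∂μ) ≤
      ∫⁻ x, edist (p x (u (i + 1))) (p x (u i)) * ENNReal.ofReal |f x| ∂μ := fun i => by
    rw [edist_eq_enorm_sub, ← integral_sub (hpf _ (hus _)) (hpf _ (hus _))]
    refine (enorm_integral_le_lintegral_enorm _).trans (lintegral_mono fun x => ?_)
    rw [← sub_mul, enorm_mul, edist_eq_enorm_sub, Real.enorm_eq_ofReal_abs (f x)]
  calc _ ≤ ∑ i ∈ Finset.range n,
        ∫⁻ x, edist (p x (u (i + 1))) (p x (u i)) * ENNReal.ofReal |f x| ∂μ :=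
        Finset.sum_le_sum fun i _ => key i
    _ = ∫⁻ x, ∑ i ∈ Finset.range n,
          edist (p x (u (i + 1))) (p x (u i)) * ENNReal.ofReal |f x| ∂μ :=
        (lintegral_finsetSum' _ fun i _ =>
          (((hpy _).edist (hpy _)).aemeasurable.mul hfm)).symm
    _ ≤ ∫⁻ x, C * ENNReal.ofReal |f x| ∂μ := by
        refine lintegral_mono_ae ?_
        filter_upwards [hv] with x hx
        rw [← Finset.sum_mul]
        gcongr
        exact (eVariationOn.sum_le hu hus).trans hx
    _ = C * ∫⁻ x, ENNReal.ofReal |f x| ∂μ := lintegral_const_mul'' _ hfm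

/-- The integral operator of a stochastic kernel is an `L¹` contraction. -/
lemma lintegral_abs_integral_kernel_le {μ : Measure ℝ} [SFinite μ] {p : ℝ → ℝ → ℝ}
    (hp : Measurable (Function.uncurry p))
    (hp0 : ∀ x y, 0 ≤ p x y)
    (hp1 : ∀ᵐ x ∂μ, ∫ y, p x y ∂μ = 1) {f : ℝ → ℝ} (hf : Integrable f μ) :
    ∫⁻ y, ENNReal.ofReal |∫ x, p x y * f x ∂μ| ∂μ ≤ ∫⁻ x, ENNReal.ofReal |f x| ∂μ := by
  have hfm : AEMeasurable (fun x => ENNReal.ofReal |f x|) μ :=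
    hf.aestronglyMeasurable.aemeasurable.abs.ennreal_ofReal
  have hpx : ∀ x, Measurable (p x) := fun x => hp.comp measurable_prodMk_left
  calc _ ≤ ∫⁻ y, ∫⁻ x, ENNReal.ofReal (p x y) * ENNReal.ofReal |f x| ∂μ ∂μ := by
        refine lintegral_mono fun y => ?_
        rw [← Real.enorm_eq_ofReal_abs]
        refine (enorm_integral_le_lintegral_enorm _).trans (lintegral_mono fun x => ?_)
        rw [enorm_mul, Real.enorm_eq_ofReal (hp0 x y), Real.enorm_eq_ofReal_abs]
    _ = ∫⁻ x, ∫⁻ y, ENNReal.ofReal (p x y) * ENNReal.ofReal |f x| ∂μ ∂μ := by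
        refine lintegral_lintegral_swap ?_
        exact ((hp.comp measurable_swap).ennreal_ofReal.aemeasurable).mul
          (hfm.comp_quasiMeasurePreserving Measure.quasiMeasurePreserving_snd)
    _ = ∫⁻ x, ENNReal.ofReal |f x| ∂μ := by
        refine lintegral_congr_ae ?_
        filter_upwards [hp1] with x hx
        have hi : Integrable (p x) μ := .of_integral_ne_zero (by simp [hx])
        rw [lintegral_mul_const _ (hpx x).ennreal_ofReal,
          ← ofReal_integral_eq_lintegral_ofReal hi (ae_of_all _ (hp0 x)), hx]
        simp

/-- The integral operator of a stochastic kernel preserves integrability. -/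
lemma integrable_integral_kernel {μ : Measure ℝ} [SFinite μ] {p : ℝ → ℝ → ℝ}
    (hp : Measurable (Function.uncurry p))
    (hp0 : ∀ x y, 0 ≤ p x y)
    (hp1 : ∀ᵐ x ∂μ, ∫ y, p x y ∂μ = 1) {f : ℝ → ℝ} (hf : Integrable f μ) :
    Integrable (fun y => ∫ x, p x y * f x ∂μ) μ := by
  refine ⟨?_, ?_⟩
  · exact AEStronglyMeasurable.integral_prod_right' (f := fun z : ℝ × ℝ => p z.2 z.1 * f z.2)
      ((hp.comp measurable_swap).aestronglyMeasurable.mul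
        (hf.aestronglyMeasurable.comp_quasiMeasurePreserving
          Measure.quasiMeasurePreserving_snd))
  · have hfin := hf.hasFiniteIntegral
    simp only [HasFiniteIntegral, Real.enorm_eq_ofReal_abs] at hfin ⊢
    exact (lintegral_abs_integral_kernel_le hp hp0 hp1 hf).trans_lt hfin

/-- Let `I = [a,b]` be a compact interval and `p` a stochastic kernel on `I`
with uniformly bounded variations, i.e. `C := esssup_{x ∈ I} |p(x,·)|_TV < ∞`, and let `L`
be the associated Markov operator `(Lρ)(y) = ∫_I p(x,y) ρ(x) dx`.  Then for every
`ρ ∈ L¹(I)` and every integer `n ≥ 1`, `‖Lⁿρ‖_BV ≤ (C+1)·‖ρ‖_{L¹}`. -/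
theorem markov_operator_iterate_bv_bound
    (a b : ℝ) (hab : a ≤ b)
    (p : ℝ → ℝ → ℝ)
    (hp_meas : Measurable (Function.uncurry p))
    (hp_nonneg : ∀ x y, 0 ≤ p x y)
    (hp_prob : ∀ x ∈ Set.Icc a b, ∫ y in Set.Icc a b, p x y = 1)
    (C : ℝ≥0∞)
    (hC : C = essSup (fun x => eVariationOn (p x) (Set.Icc a b))
      (volume.restrict (Set.Icc a b)))
    (hC_fin : C ≠ ⊤)
    (L : (ℝ → ℝ) → (ℝ → ℝ))
    (hL : ∀ f : ℝ → ℝ, L f = fun y => ∫ x in Set.Icc a b, p x y * f x)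
    (ρ : ℝ → ℝ) (hρ_int : IntegrableOn ρ (Set.Icc a b)) :
    ∀ n : ℕ, 1 ≤ n →
      eVariationOn (L^[n] ρ) (Set.Icc a b)
          + ∫⁻ y in Set.Icc a b, ENNReal.ofReal |(L^[n] ρ) y|
        ≤ (C + 1) * ∫⁻ x in Set.Icc a b, ENNReal.ofReal |ρ x| := by
  have hp1 : ∀ᵐ x ∂volume.restrict (Icc a b), ∫ y in Icc a b, p x y = 1 :=
    (ae_restrict_iff' measurableSet_Icc).2 (ae_of_all _ hp_prob)
  have hv : ∀ᵐ x ∂volume.restrict (Icc a b), eVariationOn (p x) (Icc a b) ≤ C := by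
    rw [hC]
    exact ENNReal.ae_le_essSup _
  have hlt : a < b := hab.lt_of_ne fun h => by
    have := hp_prob a ⟨le_rfl, hab⟩
    simp [← h] at this
  have hpf : ∀ f : ℝ → ℝ, IntegrableOn f (Icc a b) → ∀ y ∈ Icc a b,
      IntegrableOn (fun x => p x y * f x) (Icc a b) := fun f hf y hy => by
    refine Integrable.bdd_mul (c := (1 + (b - a) * C.toReal) / (b - a)) hf
      (hp_meas.comp (measurable_id.prodMk measurable_const)).aestronglyMeasurable ?_
    filter_upwards [hv, hp1] with x hvx hx
    have hi : IntegrableOn (p x) (Icc a b) := .of_integral_ne_zero (by simp [hx])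
    have h := mul_le_integral_add_variation hab hi hC_fin hvx hy
    rw [Real.norm_of_nonneg (hp_nonneg x y), le_div_iff₀ (sub_pos.2 hlt), mul_comm]
    rwa [hx] at h
  have hiter : ∀ n : ℕ, IntegrableOn (L^[n] ρ) (Icc a b) ∧
      ∫⁻ y in Icc a b, ENNReal.ofReal |(L^[n] ρ) y| ≤
        ∫⁻ x in Icc a b, ENNReal.ofReal |ρ x| := fun n => by
    induction n with
    | zero => exact ⟨hρ_int, le_rfl⟩
    | succ n ih =>
      rw [Function.iterate_succ_apply', hL]
      exact ⟨integrable_integral_kernel hp_meas hp_nonneg hp1 ih.1,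
        (lintegral_abs_integral_kernel_le hp_meas hp_nonneg hp1 ih.1).trans ih.2⟩
  intro n hn
  obtain ⟨n, rfl⟩ := Nat.exists_eq_add_of_le' hn
  rw [add_mul, one_mul]
  refine add_le_add ?_ (hiter (n + 1)).2
  rw [Function.iterate_succ_apply', hL]
  exact (eVariationOn_integral_kernel_le hp_meas hv (hiter n).1 (hpf _ (hiter n).1)).trans
    (mul_le_mul_right (hiter n).2 C)
end

section
/- Let I be a compact interval and T: I → I a Borel map admitting exactly one invariant probability measure μ that is absolutely continuous with respect to Lebesgue measure. For each n ∈ ℕ let P^{(n)} be a Markov kernel on I with an absolutely continuous stationary probability measure μ_n = h_n·Leb. Assume: (A_q) there exist q > 1 and C_q > 0 with ‖h_n‖_{L^q} ≤ C_q for all n; and for every x ∈ I and every continuous φ: I → ℝ, ∫ φ dP^{(n)}_x → φ(T(x)) as n → ∞. Then μ_n converges weak-* to μ as n → ∞ (weak stochastic stability). -/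
open MeasureTheory Set Filter Topology
open scoped ENNReal NNReal

/-- A bounded measurable function is approximated in measure by continuous functions with the same
bound. -/
lemma exists_boundedContinuous_measure_le {X : Type*} [TopologicalSpace X] [NormalSpace X]
    [MeasurableSpace X] [BorelSpace X] {ρ : Measure X} [IsFiniteMeasure ρ] [ρ.WeaklyRegular]
    {f : X → ℝ} (hf : Measurable f) {M : ℝ}
    (hM : 0 ≤ M) (hfM : ∀ x, |f x| ≤ M) {δ : ℝ} (hδ : 0 < δ) :
    ∃ g : BoundedContinuousFunction X ℝ, (∀ x, |g x| ≤ M) ∧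
      ρ {x | δ ≤ |f x - g x|} ≤ ENNReal.ofReal δ := by
  have hfi : Integrable f ρ :=
    Integrable.of_bound hf.aestronglyMeasurable M (ae_of_all _ hfM)
  obtain ⟨g, hg, -⟩ := hfi.exists_boundedContinuous_lintegral_sub_le
    (ε := ENNReal.ofReal δ * ENNReal.ofReal δ) (by simpa using hδ)
  have hbound : ∀ x, |max (-M) (min (g x) M)| ≤ M := fun x =>
    abs_le.2 ⟨le_max_left _ _, max_le (by linarith) (min_le_right _ _)⟩
  refine ⟨BoundedContinuousFunction.ofNormedAddCommGroup (fun x => max (-M) (min (g x) M))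
    (continuous_const.max (g.continuous.min continuous_const)) M hbound, hbound, ?_⟩
  have hsub : {x | δ ≤ |f x - max (-M) (min (g x) M)|} ⊆ {x | ENNReal.ofReal δ ≤ ‖f x - g x‖ₑ} := by
    intro x hx
    have hx : δ ≤ |f x - max (-M) (min (g x) M)| := hx
    have h1 := abs_le.1 (hfM x)
    change ENNReal.ofReal δ ≤ ‖f x - g x‖ₑ
    rw [← ofReal_norm, Real.norm_eq_abs]
    refine ENNReal.ofReal_le_ofReal (hx.trans ?_)
    grind
  refine (measure_mono hsub).trans ?_
  have h1 := mul_meas_ge_le_lintegral (μ := ρ)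
    (hf.sub g.continuous.measurable).enorm (ENNReal.ofReal δ)
  exact (ENNReal.mul_le_mul_iff_right (by simpa using hδ) ENNReal.ofReal_ne_top).1 (h1.trans hg)

/-- A set `S` of measures is uniformly absolutely continuous with respect to `ρ` if `m A` is small
uniformly over `m ∈ S` as soon as `ρ A` is small. -/
def UniformlyAbsolutelyContinuous {X : Type*} [MeasurableSpace X] (S : Set (Measure X))
    (ρ : Measure X) : Prop :=
  ∀ ε : ℝ≥0∞, ε ≠ 0 → ∃ δ : ℝ≥0∞, δ ≠ 0 ∧
    ∀ m ∈ S, ∀ A, MeasurableSet A → ρ A ≤ δ → m A ≤ ε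

namespace UniformlyAbsolutelyContinuous

section Measurable

variable {X : Type*} [MeasurableSpace X] {S : Set (Measure X)} {ρ : Measure X}

lemma absolutelyContinuous (hS : UniformlyAbsolutelyContinuous S ρ) {m : Measure X} (hm : m ∈ S) :
    m ≪ ρ := by
  refine Measure.AbsolutelyContinuous.mk fun A hA hA0 => ?_
  refine le_antisymm (le_of_forall_pos_le_add fun ε hε => ?_) zero_le
  obtain ⟨δ, -, h⟩ := hS ε hε.ne'
  rw [zero_add]
  exact h m hm A hA (by simp [hA0])

/-- Measures whose densities are bounded in `L^q`, `1 < q`, are uniformly absolutely continuous. -/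
lemma of_eLpNorm_le {h : ℕ → X → ℝ} (h_meas : ∀ n, Measurable (h n)) {q : ℝ} (hq : 1 < q)
    {C : ℝ≥0∞} (hC : C ≠ ∞) (hqC : ∀ n, eLpNorm (h n) (ENNReal.ofReal q) ρ ≤ C) :
    UniformlyAbsolutelyContinuous
      (Set.range fun n => ρ.withDensity fun x => ENNReal.ofReal (h n x)) ρ := by
  intro ε hε
  have hθ : 0 < 1 - 1 / q := by
    rw [sub_pos, div_lt_one (by linarith)]; exact hq
  have hlim : Tendsto (fun δ : ℝ≥0∞ => C * δ ^ (1 - 1 / q)) (𝓝 0) (𝓝 0) := by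
    have := ENNReal.Tendsto.const_mul (a := C)
      ((ENNReal.continuous_rpow_const (y := 1 - 1 / q)).tendsto 0) (Or.inr hC)
    rwa [ENNReal.zero_rpow_of_pos hθ, mul_zero] at this
  obtain ⟨δ, hδ, hδε⟩ := ENNReal.nhds_zero_basis_Iic.mem_iff.1
    (ENNReal.tendsto_nhds_zero.1 hlim ε (pos_iff_ne_zero.2 hε))
  refine ⟨δ, hδ.ne', ?_⟩
  rintro _ ⟨n, rfl⟩ A hA hρA
  have hp : (1 : ℝ≥0∞) ≤ ENNReal.ofReal q := by
    rw [← ENNReal.ofReal_one]; exact ENNReal.ofReal_le_ofReal hq.le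
  calc ρ.withDensity (fun x => ENNReal.ofReal (h n x)) A
      = ∫⁻ x in A, ENNReal.ofReal (h n x) ∂ρ := withDensity_apply _ hA
    _ ≤ ∫⁻ x in A, ‖h n x‖ₑ ∂ρ := by
        refine lintegral_mono fun x => ?_
        rw [← ofReal_norm]
        exact ENNReal.ofReal_le_ofReal (le_abs_self _)
    _ = eLpNorm (h n) 1 (ρ.restrict A) := eLpNorm_one_eq_lintegral_enorm.symm
    _ ≤ eLpNorm (h n) (ENNReal.ofReal q) (ρ.restrict A)
          * (ρ.restrict A) Set.univ ^ (1 / (1 : ℝ≥0∞).toReal - 1 / (ENNReal.ofReal q).toReal) :=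
        eLpNorm_le_eLpNorm_mul_rpow_measure_univ hp (h_meas n).aestronglyMeasurable
    _ ≤ C * ρ A ^ (1 - 1 / q) := by
        rw [ENNReal.toReal_ofReal (by linarith), Measure.restrict_apply_univ, ENNReal.toReal_one,
          div_one]
        gcongr
        exact (eLpNorm_mono_measure _ Measure.restrict_le_self).trans (hqC n)
    _ ≤ ε := hδε hρA

/-- Uniformly bounded functions that are small in `ρ`-measure have uniformly small integrals. -/
lemma exists_integral_abs_le (hS : UniformlyAbsolutelyContinuous S ρ) {M ε : ℝ} (hM : 0 ≤ M)
    (hε : 0 < ε) :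
    ∃ δ : ℝ, 0 < δ ∧ ∀ m ∈ S, IsProbabilityMeasure m → ∀ f : X → ℝ, Measurable f →
      (∀ x, |f x| ≤ M) → ρ {x | δ ≤ |f x|} ≤ ENNReal.ofReal δ → ∫ x, |f x| ∂m ≤ ε := by
  obtain ⟨δ₀, hδ₀, h⟩ := hS (ENNReal.ofReal (ε / (2 * (M + 1))))
    (by rw [Ne, ENNReal.ofReal_eq_zero, not_le]; positivity)
  have hfin : min δ₀ (ENNReal.ofReal (ε / 2)) ≠ ∞ :=
    ((min_le_right _ _).trans_lt ENNReal.ofReal_lt_top).ne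
  have hpos : min δ₀ (ENNReal.ofReal (ε / 2)) ≠ 0 := by
    refine (lt_min (pos_iff_ne_zero.2 hδ₀) ?_).ne'
    rw [ENNReal.ofReal_pos]; positivity
  refine ⟨(min δ₀ (ENNReal.ofReal (ε / 2))).toReal, ENNReal.toReal_pos hpos hfin, ?_⟩
  have hδε : (min δ₀ (ENNReal.ofReal (ε / 2))).toReal ≤ ε / 2 :=
    ENNReal.toReal_le_of_le_ofReal (by positivity) (min_le_right _ _)
  rw [ENNReal.ofReal_toReal hfin]
  intro m hm hprob f hf hfM hρ
  set δ := (min δ₀ (ENNReal.ofReal (ε / 2))).toReal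
  have hA : MeasurableSet {x | δ ≤ |f x|} := measurableSet_le measurable_const hf.abs
  have hmA : m.real {x | δ ≤ |f x|} ≤ ε / (2 * (M + 1)) :=
    ENNReal.toReal_le_of_le_ofReal (by positivity) (h m hm _ hA (hρ.trans (min_le_left _ _)))
  calc ∫ x, |f x| ∂m ≤ ∫ x, (δ + {x | δ ≤ |f x|}.indicator (fun _ => M) x) ∂m := by
        refine integral_mono_of_nonneg (ae_of_all _ fun x => abs_nonneg _)
          ((integrable_const _).add ((integrable_const _).indicator hA)) (ae_of_all _ fun x => ?_)
        by_cases hx : δ ≤ |f x|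
        · simpa [Set.indicator, hx] using (hfM x).trans (le_add_of_nonneg_left ENNReal.toReal_nonneg)
        · simpa [Set.indicator, hx] using (not_le.1 hx).le
    _ = δ + m.real {x | δ ≤ |f x|} * M := by
        rw [integral_add (integrable_const _) ((integrable_const _).indicator hA),
          integral_indicator_const _ hA]
        simp
    _ ≤ ε / 2 + ε / (2 * (M + 1)) * M := by gcongr
    _ ≤ ε / 2 + ε / 2 := by
        gcongr
        rw [div_mul_eq_mul_div, div_le_div_iff₀ (by positivity) (by positivity)]
        nlinarith
    _ = ε := by ring

/-- Integrals of uniformly bounded functions converging to `0` in `ρ`-measure converge to `0`. -/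
lemma tendsto_integral_of_tendsto_measure (hS : UniformlyAbsolutelyContinuous S ρ) {ι : Type*}
    {l : Filter ι} {m : ι → Measure X} (hm : ∀ i, m i ∈ S) (hprob : ∀ i, IsProbabilityMeasure (m i))
    {f : ι → X → ℝ} (hf : ∀ i, Measurable (f i)) {M : ℝ} (hM : 0 ≤ M) (hfM : ∀ i x, |f i x| ≤ M)
    (hlim : ∀ ε, 0 < ε → Tendsto (fun i => ρ {x | ε ≤ |f i x|}) l (𝓝 0)) :
    Tendsto (fun i => ∫ x, f i x ∂(m i)) l (𝓝 0) := by
  rw [Metric.tendsto_nhds]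
  intro ε hε
  obtain ⟨δ, hδ, h⟩ := hS.exists_integral_abs_le hM (half_pos hε)
  filter_upwards [ENNReal.tendsto_nhds_zero.1 (hlim δ hδ) (ENNReal.ofReal δ)
    (ENNReal.ofReal_pos.2 hδ)] with i hi
  rw [dist_zero_right]
  calc ‖∫ x, f i x ∂(m i)‖ ≤ ∫ x, |f i x| ∂(m i) := norm_integral_le_integral_norm _
    _ ≤ ε / 2 := h _ (hm i) (hprob i) _ (hf i) (hfM i) hi
    _ < ε := half_lt_self hε

end Measurable

section Topological

variable {X : Type*} [TopologicalSpace X] [MeasurableSpace X] [BorelSpace X]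
  [HasOuterApproxClosed X] {S : Set (Measure X)} {ρ : Measure X}

/-- Uniform absolute continuity passes to weak limits. -/
lemma insert_of_tendsto [ρ.OuterRegular] (hS : UniformlyAbsolutelyContinuous S ρ) {ι : Type*}
    {l : Filter ι} [l.NeBot] {m : ι → ProbabilityMeasure X} (hm : ∀ i, (m i : Measure X) ∈ S)
    {ν : ProbabilityMeasure X} (hν : Tendsto m l (𝓝 ν)) :
    UniformlyAbsolutelyContinuous (insert (ν : Measure X) S) ρ := by
  intro ε hε
  obtain ⟨δ, hδ, h⟩ := hS ε hε
  have hδ2 : δ / 2 ≠ 0 := by simpa using hδ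
  refine ⟨δ / 2, hδ2, ?_⟩
  rintro m' (rfl | hm') A hA hρA
  · obtain ⟨U, hAU, hU, hρU⟩ := A.exists_isOpen_le_add ρ hδ2
    calc (ν : Measure X) A ≤ (ν : Measure X) U := measure_mono hAU
      _ ≤ l.liminf fun i => (m i : Measure X) U :=
        ProbabilityMeasure.le_liminf_measure_open_of_tendsto hν hU
      _ ≤ ε := by
        refine (liminf_le_liminf (v := fun _ => ε) (Eventually.of_forall fun i => ?_)).trans
          (liminf_const _).le
        refine h _ (hm i) U hU.measurableSet (hρU.trans ?_)
        calc ρ A + δ / 2 ≤ δ / 2 + δ / 2 := by gcongr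
          _ = δ := ENNReal.add_halves δ
  · exact h m' hm' A hA (hρA.trans ENNReal.half_le_self)

variable [NormalSpace X] [IsFiniteMeasure ρ] [ρ.WeaklyRegular]

/-- Under uniform absolute continuity, weak convergence implies convergence of the integrals of
all bounded measurable functions. -/
lemma tendsto_integral_of_measurable (hS : UniformlyAbsolutelyContinuous S ρ) {ι : Type*}
    {l : Filter ι} [l.NeBot] {m : ι → ProbabilityMeasure X} (hm : ∀ i, (m i : Measure X) ∈ S)
    {ν : ProbabilityMeasure X} (hν : Tendsto m l (𝓝 ν)) {f : X → ℝ} (hf : Measurable f) {M : ℝ}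
    (hM : 0 ≤ M) (hfM : ∀ x, |f x| ≤ M) :
    Tendsto (fun i => ∫ x, f x ∂(m i : Measure X)) l (𝓝 (∫ x, f x ∂(ν : Measure X))) := by
  rw [Metric.tendsto_nhds]
  intro ε hε
  have hSν := hS.insert_of_tendsto hm hν
  obtain ⟨δ, hδ, h⟩ := hSν.exists_integral_abs_le (M := M + M) (ε := ε / 4) (by positivity)
    (by positivity)
  obtain ⟨g, hgM, hg⟩ := exists_boundedContinuous_measure_le (ρ := ρ) hf hM hfM hδ
  have key : ∀ m' : ProbabilityMeasure X, (m' : Measure X) ∈ insert (ν : Measure X) S →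
      |∫ x, f x ∂(m' : Measure X) - ∫ x, g x ∂(m' : Measure X)| ≤ ε / 4 := by
    intro m' hm'
    have hfi : Integrable f (m' : Measure X) :=
      Integrable.of_bound hf.aestronglyMeasurable M (ae_of_all _ hfM)
    rw [← integral_sub hfi (g.integrable _)]
    refine (norm_integral_le_integral_norm (fun x => f x - g x)).trans ?_
    exact h _ hm' inferInstance (fun x => f x - g x) (hf.sub g.continuous.measurable)
      (fun x => (abs_sub _ _).trans (add_le_add (hfM x) (hgM x))) hg
  have hgν := ProbabilityMeasure.tendsto_iff_forall_integral_tendsto.1 hν g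
  filter_upwards [Metric.tendsto_nhds.1 hgν (ε / 4) (by positivity)] with i hi
  have h1 := abs_le.1 (key (m i) (Set.mem_insert_of_mem _ (hm i)))
  have h2 := abs_le.1 (key ν (Set.mem_insert _ _))
  rw [Real.dist_eq, abs_lt] at hi ⊢
  constructor <;> linarith [hi.1, hi.2, h1.1, h1.2, h2.1, h2.2]

/-- A weak limit of stationary measures of kernels converging to `T` is `T`-invariant, provided the
stationary measures are uniformly absolutely continuous. -/
lemma map_eq_of_tendsto_stationary (hS : UniformlyAbsolutelyContinuous S ρ)
    {l : Filter ℕ} [l.NeBot] (hl : l ≤ atTop) {m : ℕ → ProbabilityMeasure X}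
    (hm : ∀ n, (m n : Measure X) ∈ S) {ν : ProbabilityMeasure X} (hν : Tendsto m l (𝓝 ν))
    {T : X → X} (hT : Measurable T) {κ : ℕ → ProbabilityTheory.Kernel X X}
    (hκ : ∀ n, ProbabilityTheory.IsMarkovKernel (κ n))
    (hstat : ∀ n, (m n : Measure X).bind (κ n) = m n)
    (hker : ∀ φ : BoundedContinuousFunction X ℝ, ∀ᵐ x ∂ρ,
      Tendsto (fun n => ∫ y, φ y ∂(κ n x)) atTop (𝓝 (φ (T x)))) :
    (ν : Measure X).map T = ν := by
  have := Measure.isProbabilityMeasure_map (μ := (ν : Measure X)) hT.aemeasurable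
  refine ext_of_forall_integral_eq_of_IsFiniteMeasure fun φ => ?_
  rw [integral_map hT.aemeasurable φ.continuous.aestronglyMeasurable]
  have hφ : ∀ x, |φ x| ≤ ‖φ‖ := φ.norm_coe_le_norm
  have hφT : Measurable fun x => φ (T x) := φ.continuous.measurable.comp hT
  have hφκ : ∀ n, StronglyMeasurable fun x => ∫ y, φ y ∂(κ n x) := fun n =>
    φ.continuous.measurable.stronglyMeasurable.integral_kernel
  have hφκ_le : ∀ n x, |∫ y, φ y ∂(κ n x)| ≤ ‖φ‖ := fun n x => by
    simpa using norm_integral_le_of_norm_le_const (μ := κ n x) (ae_of_all _ φ.norm_coe_le_norm)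
  have h_diff : Tendsto (fun n => ∫ x, (∫ y, φ y ∂(κ n x)) - φ (T x) ∂(m n : Measure X)) l
      (𝓝 0) := by
    refine hS.tendsto_integral_of_tendsto_measure hm (fun _ => inferInstance)
      (fun n => (hφκ n).measurable.sub hφT) (M := ‖φ‖ + ‖φ‖) (by positivity)
      (fun n x => (abs_sub _ _).trans (add_le_add (hφκ_le n x) (hφ _))) fun ε hε => ?_
    have h_meas := tendstoInMeasure_of_tendsto_ae (fun n => (hφκ n).aestronglyMeasurable) (hker φ)
    refine (h_meas (ENNReal.ofReal ε) (ENNReal.ofReal_pos.2 hε)).mono_left hl |>.congr fun n => ?_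
    congr 1 with x
    simp [edist_dist, Real.dist_eq, ENNReal.ofReal_le_ofReal_iff (abs_nonneg _)]
  have h_eq : ∀ n, ∫ x, (∫ y, φ y ∂(κ n x)) - φ (T x) ∂(m n : Measure X)
      = ∫ x, φ x ∂(m n : Measure X) - ∫ x, φ (T x) ∂(m n : Measure X) := by
    intro n
    have h_int : Integrable φ ((m n : Measure X).bind (κ n)) := by
      rw [hstat n]; exact φ.integrable _
    have h_bind : ∫ x, φ x ∂(m n : Measure X).bind (κ n)
        = ∫ x, (∫ y, φ y ∂(κ n x)) ∂(m n : Measure X) := by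
      rw [Measure.comp_eq_comp_const_apply] at h_int ⊢
      rw [ProbabilityTheory.Kernel.integral_comp h_int, ProbabilityTheory.Kernel.const_apply]
    rw [integral_sub
      (Integrable.of_bound (hφκ n).aestronglyMeasurable ‖φ‖ (ae_of_all _ (hφκ_le n)))
      (Integrable.of_bound hφT.aestronglyMeasurable ‖φ‖ (ae_of_all _ fun x => hφ (T x))),
      ← h_bind, hstat n]
  simp_rw [h_eq] at h_diff
  have h1 := ProbabilityMeasure.tendsto_iff_forall_integral_tendsto.1 hν φ
  have h2 := hS.tendsto_integral_of_measurable hm hν hφT (norm_nonneg φ) fun x => hφ (T x)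
  exact (sub_eq_zero.1 (tendsto_nhds_unique (h1.sub h2) h_diff)).symm

end Topological

end UniformlyAbsolutelyContinuous

/-- Let `I = [a,b]` be a compact interval and `T : I → I` a Borel map
admitting exactly one absolutely continuous invariant probability measure `μ`.  For each
`n` let `P⁽ⁿ⁾` be a Markov kernel on `I` with an absolutely continuous stationary
probability measure `μ_n = h_n·Leb`.  Assume `(A_q)`: there are `q > 1`, `C_q > 0` with
`‖h_n‖_q ≤ C_q` for all `n`; and `∫ φ dP⁽ⁿ⁾_x → φ(T x)` for every `x ∈ I` and continuous
`φ`.  Then `μ_n → μ` weak-* (weak stochastic stability). -/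
theorem weak_stochastic_stability
    (a b : ℝ) (hab : a ≤ b)
    (T : ℝ → ℝ) (hT_meas : Measurable T)
    (hT_maps : Set.MapsTo T (Set.Icc a b) (Set.Icc a b))
    (μ : Measure ℝ) (hμ_prob : IsProbabilityMeasure μ)
    (hμ_ac : μ ≪ volume) (hμ_supp : μ (Set.Icc a b)ᶜ = 0)
    (hμ_inv : ∀ A : Set ℝ, MeasurableSet A → μ (T ⁻¹' A) = μ A)
    (hμ_uniq : ∀ ν : Measure ℝ, IsProbabilityMeasure ν → ν ≪ volume →
      ν (Set.Icc a b)ᶜ = 0 → (∀ A : Set ℝ, MeasurableSet A → ν (T ⁻¹' A) = ν A) → ν = μ)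
    (P : ℕ → ℝ → Measure ℝ) (hP_meas : ∀ n, Measurable (P n))
    (hP_prob : ∀ n, ∀ x ∈ Set.Icc a b, IsProbabilityMeasure (P n x))
    (hP_supp : ∀ n, ∀ x ∈ Set.Icc a b, P n x (Set.Icc a b)ᶜ = 0)
    (h : ℕ → ℝ → ℝ) (h_meas : ∀ n, Measurable (h n)) (h_nonneg : ∀ n x, 0 ≤ h n x)
    (μn : ℕ → Measure ℝ)
    (hμn : ∀ n, μn n
      = (volume.restrict (Set.Icc a b)).withDensity (fun x => ENNReal.ofReal (h n x)))
    (hμn_prob : ∀ n, IsProbabilityMeasure (μn n))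
    (hμn_stat : ∀ n, ∀ A : Set ℝ, MeasurableSet A → μn n A = ∫⁻ x, P n x A ∂(μn n))
    -- (A_q)
    (q : ℝ) (hq : 1 < q) (Cq : ℝ) (hCq : 0 < Cq)
    (hAq : ∀ n, eLpNorm (h n) (ENNReal.ofReal q) (volume.restrict (Set.Icc a b))
      ≤ ENNReal.ofReal Cq)
    -- kernel convergence
    (hker : ∀ x ∈ Set.Icc a b, ∀ φ : ℝ → ℝ, Continuous φ →
      Tendsto (fun n => ∫ y, φ y ∂(P n x)) atTop (nhds (φ (T x)))) :
    ∀ φ : ℝ → ℝ, Continuous φ →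
      Tendsto (fun n => ∫ x, φ x ∂(μn n)) atTop (nhds (∫ x, φ x ∂μ)) := by
  classical
  set ρ : Measure ℝ := volume.restrict (Set.Icc a b) with hρ
  have hS := UniformlyAbsolutelyContinuous.of_eLpNorm_le h_meas hq ENNReal.ofReal_ne_top hAq
  let m : ℕ → ProbabilityMeasure ℝ := fun n => ⟨μn n, hμn_prob n⟩
  have hm : ∀ n, (m n : Measure ℝ) ∈
      Set.range fun n => ρ.withDensity fun x => ENNReal.ofReal (h n x) :=
    fun n => ⟨n, (hμn n).symm⟩
  have hρ_compl : ρ (Set.Icc a b)ᶜ = 0 := by simp [hρ, measurableSet_Icc.compl]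
  have hμn_supp : ∀ n, μn n (Set.Icc a b)ᶜ = 0 := fun n =>
    hS.absolutelyContinuous (hm n) hρ_compl
  have hIcc : ∀ᵐ x ∂ρ, x ∈ Set.Icc a b := hρ_compl
  have hμn_Icc : ∀ n, ∀ᵐ x ∂(μn n), x ∈ Set.Icc a b := hμn_supp
  let κ : ℕ → ProbabilityTheory.Kernel ℝ ℝ := fun n =>
    ProbabilityTheory.Kernel.piecewise (measurableSet_Icc (a := a) (b := b)) ⟨P n, hP_meas n⟩
      (ProbabilityTheory.Kernel.id (α := ℝ))
  have hκ_apply : ∀ n, ∀ x ∈ Set.Icc a b, κ n x = P n x := fun n x hx => by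
    simp only [κ, ProbabilityTheory.Kernel.piecewise_apply, if_pos hx]
    rfl
  have hκ : ∀ n, ProbabilityTheory.IsMarkovKernel (κ n) := fun n => ⟨fun x => by
    by_cases hx : x ∈ Set.Icc a b
    · rw [hκ_apply n x hx]
      exact hP_prob n x hx
    · simp only [κ, ProbabilityTheory.Kernel.piecewise_apply, if_neg hx]
      infer_instance⟩
  have hstat : ∀ n, (m n : Measure ℝ).bind (κ n) = m n := fun n => by
    ext A hA
    rw [Measure.bind_apply hA (κ n).measurable.aemeasurable]
    refine Eq.trans ?_ (hμn_stat n A hA).symm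
    refine lintegral_congr_ae ?_
    filter_upwards [hμn_Icc n] with x hx
    rw [hκ_apply n x hx]
  have hκ_lim : ∀ φ : BoundedContinuousFunction ℝ ℝ, ∀ᵐ x ∂ρ,
      Tendsto (fun n => ∫ y, φ y ∂(κ n x)) atTop (𝓝 (φ (T x))) := fun φ => by
    filter_upwards [hIcc] with x hx
    simp_rw [hκ_apply _ x hx]
    exact hker x hx φ φ.continuous
  have hcompact : IsCompact (closure (Set.range m)) := by
    refine isCompact_closure_of_isTightMeasureSet ?_
    rw [isTightMeasureSet_iff_exists_isCompact_measure_compl_le]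
    refine fun ε _ => ⟨Set.Icc a b, isCompact_Icc, ?_⟩
    rintro _ ⟨_, ⟨n, rfl⟩, rfl⟩
    exact (hμn_supp n).trans_le zero_le
  have hlim : Tendsto m atTop (𝓝 ⟨μ, hμ_prob⟩) := by
    rw [tendsto_iff_ultrafilter]
    intro l hl
    obtain ⟨ν, -, hν⟩ := hcompact.ultrafilter_le_nhds (l.map m)
      (le_principal_iff.2 (Filter.mem_of_superset (Filter.range_mem_map) subset_closure))
    have hν : Tendsto m l (𝓝 ν) := hν
    have hν_ac : (ν : Measure ℝ) ≪ ρ :=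
      (hS.insert_of_tendsto hm hν).absolutelyContinuous (Set.mem_insert _ _)
    have hν_inv := hS.map_eq_of_tendsto_stationary hl hm hν hT_meas hκ hstat hκ_lim
    have hνμ : (ν : Measure ℝ) = μ := by
      refine hμ_uniq ν inferInstance (hν_ac.trans Measure.restrict_le_self.absolutelyContinuous)
        (hν_ac hρ_compl) fun A hA => ?_
      rw [← Measure.map_apply hT_meas hA, hν_inv]
    rwa [show ν = ⟨μ, hμ_prob⟩ from Subtype.ext hνμ] at hν
  intro φ hφ
  have hext : ∀ m' : Measure ℝ, m' (Set.Icc a b)ᶜ = 0 →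
      ∫ x, φ (Set.projIcc a b hab x) ∂m' = ∫ x, φ x ∂m' := fun m' hm' => by
    have hm' : ∀ᵐ x ∂m', x ∈ Set.Icc a b := hm'
    refine integral_congr_ae ?_
    filter_upwards [hm'] with x hx
    rw [Set.projIcc_of_mem hab hx]
  let ψ : BoundedContinuousFunction ℝ ℝ :=
    (BoundedContinuousFunction.mkOfCompact
      ⟨fun x : Set.Icc a b => φ x, hφ.comp continuous_subtype_val⟩).compContinuous
      ⟨Set.projIcc a b hab, continuous_projIcc⟩
  have hψ := ProbabilityMeasure.tendsto_iff_forall_integral_tendsto.1 hlim ψ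
  rw [← hext μ hμ_supp]
  simp_rw [← hext (μn _) (hμn_supp _)]
  exact hψ
end

section
/- Let I be a compact interval and T: I → I a continuous map with a fixed point x₀ ∈ I such that T^k → x₀ uniformly on I (sup_{x∈I} |T^k(x) − x₀| → 0 as k → ∞). For each n ∈ ℕ let {T^{(n)}_η : η ∈ [0,1]} be a family of maps I → I, jointly measurable in (η, x), and let μ_n be a Borel probability measure on I that is stationary for the random maps: μ_n(A) = ∫₀¹ μ_n((T^{(n)}_η)^{−1}A) dη for every Borel set A ⊆ I. Denote S_n := supp μ_n. Assume: (i) for every δ > 0, sup_{η∈[δ,1−δ]} sup_{x∈I} |T^{(n)}_η(x) − T(x)| → 0 as n → ∞; (ii) there is τ < 1 such that |T(a) − T(b)| ≤ τ|a − b| for all a, b ∈ S_n and all n; (iii) T(S_n) ⊆ S_n and T^{(n)}_η(S_n) ⊆ S_n for every η ∈ [0,1] and every n. Then μ_n converges weak-* to δ_{x₀}: ∫ φ dμ_n → φ(x₀) for every continuous φ: I → ℝ. -/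
open MeasureTheory Set Filter Topology
open scoped ENNReal NNReal

/-- The topological support of a Borel measure on `ℝ`. -/
def measSupp (μ : MeasureTheory.Measure ℝ) : Set ℝ :=
  {x | ∀ U : Set ℝ, IsOpen U → x ∈ U → 0 < μ U}

theorem measSupp_eq_support (μ : Measure ℝ) : measSupp μ = μ.support := by
  rw [Measure.support_eq_forall_isOpen]
  ext x
  exact ⟨fun h U hx hU => h U hU hx, fun h U hU hx => h U hx hU⟩

/-- A value of a function bounded above on `s` is at most its supremum over `s`. -/
theorem Real.le_biSup {α : Type*} {s : Set α} {f : α → ℝ} {C : ℝ} (hC : ∀ x ∈ s, f x ≤ C)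
    {x : α} (hx : x ∈ s) : f x ≤ ⨆ y ∈ s, f y := by
  refine le_ciSup₂ (f := fun y (_ : y ∈ s) => f y) ⟨C, ?_⟩ x hx
  rintro _ ⟨_, ⟨y, rfl⟩, ⟨hy, rfl⟩⟩
  exact hC y hy

theorem Real.biSup_le {α : Type*} {s : Set α} {f : α → ℝ} {C : ℝ} (hC : ∀ x ∈ s, f x ≤ C)
    (h0 : 0 ≤ C) : ⨆ y ∈ s, f y ≤ C :=
  Real.iSup_le (fun y => Real.iSup_le (hC y) h0) h0

/-- A measure stationary for the random maps `F η`, with `η` distributed according to `ρ`,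
is the image of the product measure under `(η, x) ↦ F η x`. -/
theorem map_uncurry_prod_eq_of_stationary {α β : Type*} [MeasurableSpace α] [MeasurableSpace β]
    {ρ : Measure α} {μ : Measure β} [SFinite μ] {F : α → β → β}
    (hF : Measurable (Function.uncurry F))
    (hstat : ∀ A, MeasurableSet A → μ A = ∫⁻ η, μ (F η ⁻¹' A) ∂ρ) :
    (ρ.prod μ).map (Function.uncurry F) = μ := by
  ext A hA
  rw [Measure.map_apply hF hA, Measure.prod_apply (hF hA), hstat A hA]
  rfl

/-- A map contracting towards `x₀` on a set of full measure, perturbed by at most `ε` for all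
`η` outside a set `B`, has stationary measures concentrated near `x₀`. -/
theorem integral_abs_sub_le_of_stationary {α : Type*} [MeasurableSpace α] {ρ : Measure α}
    [IsProbabilityMeasure ρ] {μ : Measure ℝ} [IsProbabilityMeasure μ] {F : α → ℝ → ℝ}
    (hF : Measurable (Function.uncurry F))
    (hstat : ∀ A, MeasurableSet A → μ A = ∫⁻ η, μ (F η ⁻¹' A) ∂ρ)
    {T : ℝ → ℝ} {x₀ τ ε L : ℝ} (hε : 0 ≤ ε) {B : Set α} (hB : MeasurableSet B)
    (hint : Integrable (fun x => |x - x₀|) μ)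
    (hT : ∀ᵐ x ∂μ, |T x - x₀| ≤ τ * |x - x₀|)
    (hgood : ∀ᵐ p ∂ρ.prod μ, p.1 ∉ B → |F p.1 p.2 - T p.2| ≤ ε)
    (hbad : ∀ᵐ p ∂ρ.prod μ, |F p.1 p.2 - T p.2| ≤ L) :
    (1 - τ) * ∫ x, |x - x₀| ∂μ ≤ ε + L * ρ.real B := by
  have hmap := map_uncurry_prod_eq_of_stationary hF hstat
  have hsnd : Integrable (fun p : α × ℝ => |p.2 - x₀|) (ρ.prod μ) :=
    hint.comp_snd ρ
  have hBint : Integrable (fun p : α × ℝ => B.indicator (fun _ => L) p.1) (ρ.prod μ) :=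
    ((integrable_const L).indicator hB).comp_fst μ
  have hFint : Integrable (fun p : α × ℝ => |F p.1 p.2 - x₀|) (ρ.prod μ) := by
    rw [← hmap] at hint
    exact hint.comp_measurable hF
  have hbound : ∀ᵐ p ∂ρ.prod μ, |F p.1 p.2 - x₀| ≤
      ε + B.indicator (fun _ => L) p.1 + τ * |p.2 - x₀| := by
    filter_upwards [hgood, hbad, (measurePreserving_snd (μ := ρ)
      (ν := μ)).quasiMeasurePreserving.ae hT] with p h₁ h₂ h₃
    have htri := abs_sub_le (F p.1 p.2) (T p.2) x₀
    by_cases hp : p.1 ∈ B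
    · rw [indicator_of_mem hp]
      linarith
    · rw [indicator_of_notMem hp]
      linarith [h₁ hp]
  have hsum : Integrable (fun p : α × ℝ => ε + B.indicator (fun _ => L) p.1) (ρ.prod μ) :=
    (integrable_const ε).add hBint
  have key : ∫ p, |F p.1 p.2 - x₀| ∂ρ.prod μ ≤
      ∫ p, (ε + B.indicator (fun _ => L) p.1 + τ * |p.2 - x₀|) ∂ρ.prod μ :=
    integral_mono_ae hFint (hsum.add (hsnd.const_mul τ)) hbound
  have h₁ : ∫ p, |F p.1 p.2 - x₀| ∂ρ.prod μ = ∫ x, |x - x₀| ∂μ := by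
    conv_rhs => rw [← hmap]
    rw [integral_map hF.aemeasurable (by fun_prop)]
    rfl
  have h₂ : ∫ p : α × ℝ, |p.2 - x₀| ∂ρ.prod μ = ∫ x, |x - x₀| ∂μ := by
    rw [integral_fun_snd (μ := ρ) (fun x => |x - x₀|)]
    simp
  have h₃ : ∫ p : α × ℝ, B.indicator (fun _ => L) p.1 ∂ρ.prod μ = L * ρ.real B := by
    rw [integral_fun_fst (ν := μ) (B.indicator fun _ => L), integral_indicator_const L hB]
    simp [mul_comm]
  rw [integral_add hsum (hsnd.const_mul τ),
    integral_add (integrable_const ε) hBint, integral_const_mul, h₁, h₂, h₃] at key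
  simp only [integral_const, probReal_univ, one_smul] at key
  linarith

/-- Probability measures on a compact set `K` whose mean distance to `x₀ ∈ K` tends to zero
converge to the Dirac mass at `x₀`. -/
theorem tendsto_integral_of_tendsto_integral_abs_sub {ι : Type*} {l : Filter ι}
    {μ : ι → Measure ℝ} [∀ i, IsProbabilityMeasure (μ i)] {K : Set ℝ} (hK : IsCompact K)
    (hμK : ∀ i, ∀ᵐ x ∂μ i, x ∈ K) {x₀ : ℝ} (hx₀ : x₀ ∈ K)
    (h : Tendsto (fun i => ∫ x, |x - x₀| ∂μ i) l (𝓝 0)) {φ : ℝ → ℝ} (hφ : Continuous φ) :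
    Tendsto (fun i => ∫ x, φ x ∂μ i) l (𝓝 (φ x₀)) := by
  have hint : ∀ ψ : ℝ → ℝ, Continuous ψ → ∀ i, Integrable ψ (μ i) := by
    intro ψ hψ i
    obtain ⟨C, hC⟩ := hK.exists_bound_of_continuousOn hψ.continuousOn
    exact Integrable.of_bound hψ.aestronglyMeasurable C ((hμK i).mono hC)
  obtain ⟨M, hM⟩ := hK.exists_bound_of_continuousOn hφ.continuousOn
  have hM0 : 0 ≤ M := (norm_nonneg _).trans (hM x₀ hx₀)
  rw [Metric.tendsto_nhds]
  intro ε hε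
  obtain ⟨r, hr, hφr⟩ := Metric.continuous_iff.1 hφ x₀ (ε / 2) (half_pos hε)
  have hlim : Tendsto (fun i => 2 * M / r * ∫ x, |x - x₀| ∂μ i) l (𝓝 0) := by
    simpa using h.const_mul (2 * M / r)
  filter_upwards [hlim.eventually (gt_mem_nhds (half_pos hε))] with i hi
  have hpt : ∀ᵐ x ∂μ i, |φ x - φ x₀| ≤ ε / 2 + 2 * M / r * |x - x₀| := by
    filter_upwards [hμK i] with x hx
    by_cases hxr : |x - x₀| < r
    · have : |φ x - φ x₀| < ε / 2 := hφr x hxr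
      have : 0 ≤ 2 * M / r * |x - x₀| := by positivity
      linarith
    · have h₁ : |φ x - φ x₀| ≤ 2 * M := by
        have := abs_sub (φ x) (φ x₀)
        have := hM x hx
        have := hM x₀ hx₀
        simp only [Real.norm_eq_abs] at *
        linarith
      have h₂ : 2 * M ≤ 2 * M / r * |x - x₀| := by
        rw [div_mul_eq_mul_div, le_div_iff₀ hr]
        exact mul_le_mul_of_nonneg_left (not_lt.1 hxr) (by positivity)
      linarith
  have hd : Integrable (fun x => |x - x₀|) (μ i) := hint _ (by fun_prop) i
  calc dist (∫ x, φ x ∂μ i) (φ x₀) = |∫ x, (φ x - φ x₀) ∂μ i| := by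
        rw [integral_sub (hint φ hφ i) (integrable_const _), Real.dist_eq]
        simp
    _ ≤ ∫ x, |φ x - φ x₀| ∂μ i := abs_integral_le_integral_abs
    _ ≤ ∫ x, (ε / 2 + 2 * M / r * |x - x₀|) ∂μ i :=
        integral_mono_ae (hint _ (by fun_prop) i)
          ((integrable_const _).add (hd.const_mul _)) hpt
    _ = ε / 2 + 2 * M / r * ∫ x, |x - x₀| ∂μ i := by
        rw [integral_add (integrable_const _) (hd.const_mul _), integral_const_mul]
        simp
    _ < ε := by linarith

/-- Let `I = [a,b]` be a compact interval and `T : I → I` continuous with a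
fixed point `x₀` such that `Tᵏ → x₀` uniformly on `I`.  For each `n` let
`{T⁽ⁿ⁾_η : η ∈ [0,1]}` be a jointly measurable family of maps `I → I` and `μ_n` a Borel
probability measure on `I` stationary for the random maps.  Assume: (i) for every `δ > 0`,
`sup_{η ∈ [δ,1-δ]} sup_{x ∈ I} |T⁽ⁿ⁾_η(x) - T(x)| → 0`; (ii) there is `τ < 1` with
`|T a - T b| ≤ τ|a - b|` for `a, b ∈ S_n := supp μ_n` and all `n`; (iii) `T(S_n) ⊆ S_n`
and `T⁽ⁿ⁾_η(S_n) ⊆ S_n` for all `η, n`.  Then `μ_n → δ_{x₀}` weak-*. -/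
theorem random_maps_stability_fixed_point
    (a b : ℝ) (hab : a ≤ b)
    (T : ℝ → ℝ) (hT_cont : ContinuousOn T (Set.Icc a b))
    (hT_maps : Set.MapsTo T (Set.Icc a b) (Set.Icc a b))
    (x₀ : ℝ) (hx₀ : x₀ ∈ Set.Icc a b) (hfix : T x₀ = x₀)
    (hunif : Tendsto (fun k => ⨆ x ∈ Set.Icc a b, |T^[k] x - x₀|) atTop (nhds 0))
    (Tn : ℕ → ℝ → ℝ → ℝ)
    (hTn_meas : ∀ n, Measurable (Function.uncurry (Tn n)))
    (hTn_maps : ∀ n, ∀ η ∈ Set.Icc (0:ℝ) 1,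
      Set.MapsTo (Tn n η) (Set.Icc a b) (Set.Icc a b))
    (μn : ℕ → Measure ℝ)
    (hμn_prob : ∀ n, IsProbabilityMeasure (μn n))
    (hμn_supp : ∀ n, μn n (Set.Icc a b)ᶜ = 0)
    (hμn_stat : ∀ n, ∀ A : Set ℝ, MeasurableSet A →
      μn n A = ∫⁻ η in Set.Icc (0:ℝ) 1, μn n (Tn n η ⁻¹' A))
    -- (i)
    (hclose : ∀ δ > (0:ℝ), Tendsto
      (fun n => ⨆ η ∈ Set.Icc δ (1 - δ), ⨆ x ∈ Set.Icc a b, |Tn n η x - T x|)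
      atTop (nhds 0))
    -- (ii)
    (τ : ℝ) (hτ : τ < 1)
    (hT_contr : ∀ n, ∀ a' ∈ measSupp (μn n), ∀ b' ∈ measSupp (μn n),
      |T a' - T b'| ≤ τ * |a' - b'|)
    -- (iii)
    (hS_inv : ∀ n, Set.MapsTo T (measSupp (μn n)) (measSupp (μn n)))
    (hS_inv' : ∀ n, ∀ η ∈ Set.Icc (0:ℝ) 1,
      Set.MapsTo (Tn n η) (measSupp (μn n)) (measSupp (μn n))) :
    ∀ φ : ℝ → ℝ, Continuous φ →
      Tendsto (fun n => ∫ x, φ x ∂(μn n)) atTop (nhds (φ x₀)) := by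
  have hmem : ∀ n, ∀ᵐ x ∂μn n, x ∈ Icc a b := fun n => mem_ae_iff.2 (hμn_supp n)
  have hdist : ∀ x ∈ Icc a b, ∀ y ∈ Icc a b, |x - y| ≤ b - a := fun x hx y hy =>
    abs_sub_le_iff.2 ⟨by linarith [hx.2, hy.1], by linarith [hx.1, hy.2]⟩
  have hiter : ∀ x ∈ Icc a b, Tendsto (fun k => T^[k] x) atTop (𝓝 x₀) := by
    intro x hx
    rw [tendsto_iff_dist_tendsto_zero]
    refine squeeze_zero (fun _ => dist_nonneg) (fun k => ?_) hunif
    exact Real.le_biSup (f := fun x => |T^[k] x - x₀|)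
      (fun y hy => hdist _ (hT_maps.iterate k hy) _ hx₀) hx
  have hsupp_ae : ∀ n, ∀ᵐ x ∂μn n, x ∈ measSupp (μn n) := fun n => by
    rw [measSupp_eq_support]
    exact Measure.support_mem_ae
  have hx₀_supp : ∀ n, x₀ ∈ measSupp (μn n) := by
    intro n
    obtain ⟨x, hxI, hxS⟩ := ((hmem n).and (hsupp_ae n)).exists
    have hclosed : IsClosed (measSupp (μn n)) :=
      measSupp_eq_support (μn n) ▸ Measure.isClosed_support
    exact hclosed.mem_of_tendsto (hiter x hxI)
      (Eventually.of_forall fun k => (hS_inv n).iterate k hxS)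
  have hprob : IsProbabilityMeasure (volume.restrict (Icc (0:ℝ) 1)) := ⟨by simp⟩
  have hint : ∀ n, Integrable (fun x => |x - x₀|) (μn n) := fun n =>
    Integrable.of_bound (by fun_prop) (b - a) <| (hmem n).mono fun x hx => by
      simpa using hdist x hx x₀ hx₀
  have hbound : ∀ δ > (0:ℝ), ∀ n, (1 - τ) * ∫ x, |x - x₀| ∂μn n ≤
      (⨆ η ∈ Icc δ (1 - δ), ⨆ x ∈ Icc a b, |Tn n η x - T x|) + (b - a) * (2 * δ) := by
    intro δ hδ n
    have hab' : 0 ≤ b - a := sub_nonneg.2 hab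
    have hpair : ∀ᵐ p ∂(volume.restrict (Icc (0:ℝ) 1)).prod (μn n),
        p.1 ∈ Icc (0:ℝ) 1 ∧ p.2 ∈ Icc a b :=
      (measurePreserving_fst.quasiMeasurePreserving.ae
        (ae_restrict_mem measurableSet_Icc)).and
        (measurePreserving_snd.quasiMeasurePreserving.ae (hmem n))
    have hbad : ∀ η ∈ Icc (0:ℝ) 1, ∀ x ∈ Icc a b, |Tn n η x - T x| ≤ b - a :=
      fun η hη x hx => hdist _ (hTn_maps n η hη hx) _ (hT_maps hx)
    have hsub : Icc δ (1 - δ) ⊆ Icc (0:ℝ) 1 := Icc_subset_Icc hδ.le (by linarith)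
    have hsup : 0 ≤ ⨆ η ∈ Icc δ (1 - δ), ⨆ x ∈ Icc a b, |Tn n η x - T x| :=
      Real.iSup_nonneg fun η => Real.iSup_nonneg fun _ => Real.iSup_nonneg fun x =>
        Real.iSup_nonneg fun _ => abs_nonneg _
    refine (integral_abs_sub_le_of_stationary (hTn_meas n) (hμn_stat n)
      (L := b - a) (B := (Icc δ (1 - δ))ᶜ)
      hsup measurableSet_Icc.compl (hint n)
      ((hsupp_ae n).mono fun x hx => ?_) (hpair.mono ?_)
      (hpair.mono fun p hp => hbad _ hp.1 _ hp.2)).trans ?_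
    · simpa only [hfix] using hT_contr n x hx x₀ (hx₀_supp n)
    · rintro ⟨η, x⟩ ⟨hη, hx⟩ hηB
      exact (Real.le_biSup (f := fun x => |Tn n η x - T x|) (hbad η hη) hx).trans
        (Real.le_biSup (f := fun η => ⨆ x ∈ Icc a b, |Tn n η x - T x|)
          (fun η' hη' => Real.biSup_le (hbad η' (hsub hη')) hab') (not_not.1 hηB))
    · have hvol : (volume.restrict (Icc (0:ℝ) 1)).real (Icc δ (1 - δ))ᶜ ≤ 2 * δ := by
        rw [probReal_compl_eq_one_sub measurableSet_Icc,
          measureReal_restrict_apply measurableSet_Icc, inter_eq_left.2 hsub, Real.volume_real_Icc]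
        linarith [le_max_left (1 - δ - δ) 0]
      gcongr
  have hlim : Tendsto (fun n => (1 - τ) * ∫ x, |x - x₀| ∂μn n) atTop (𝓝 0) := by
    have hτ' : 0 ≤ 1 - τ := by linarith
    rw [Metric.tendsto_nhds]
    intro ε hε
    have hL : 0 < b - a + 1 := by linarith
    set δ := ε / (4 * (b - a + 1)) with hδ_def
    have hδ : 0 < δ := by positivity
    have hδε : (b - a) * (2 * δ) ≤ ε / 2 := by
      have : δ * (4 * (b - a + 1)) = ε := div_mul_cancel₀ _ (by positivity)
      linarith
    filter_upwards [(hclose δ hδ).eventually (gt_mem_nhds (half_pos hε))] with n hn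
    have h0 : 0 ≤ (1 - τ) * ∫ x, |x - x₀| ∂μn n :=
      mul_nonneg hτ' (integral_nonneg fun _ => abs_nonneg _)
    rw [Real.dist_eq, sub_zero, abs_of_nonneg h0]
    linarith [hbound δ hδ n]
  have hτ' : 1 - τ ≠ 0 := by linarith
  have hmean : Tendsto (fun n => ∫ x, |x - x₀| ∂μn n) atTop (𝓝 0) := by
    simpa [hτ'] using hlim.const_mul (1 - τ)⁻¹
  exact fun φ hφ => tendsto_integral_of_tendsto_integral_abs_sub isCompact_Icc hmem hx₀ hmean hφ
end

section
/- Let I be a compact interval, (μ_n) Borel probability measures on I converging weak-* to a Borel probability measure μ, and c ∈ I with μ({c}) > 0. Let g: I → [−∞, ∞) be bounded above, continuous on I ∖ {c}, with g(c) = −∞ and g(x) → −∞ as x → c. Then ∫ g dμ_n → −∞ as n → ∞ (integrals taken in the extended sense). -/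
open MeasureTheory Set Filter Topology
open scoped ENNReal NNReal

/-- Conversion from `EReal` to `ℝ≥0∞` (negative values are sent to `0`, `⊤` to `⊤`). -/
noncomputable def erealToENNReal (x : EReal) : ℝ≥0∞ :=
  if x = ⊤ then ⊤ else ENNReal.ofReal x.toReal

theorem ofReal_le_erealToENNReal_sub {M K : ℝ} {y : EReal} (hy : y < ((M - K : ℝ) : EReal)) :
    ENNReal.ofReal K ≤ erealToENNReal ((M : EReal) - y) := by
  induction y with
  | bot => simp [erealToENNReal]
  | coe r =>
    have hr : r < M - K := by exact_mod_cast hy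
    rw [← EReal.coe_sub, erealToENNReal, if_neg (EReal.coe_ne_top _), EReal.toReal_coe]
    exact ENNReal.ofReal_le_ofReal (by linarith)
  | top => exact absurd hy (not_lt.2 le_top)

/-- The tent function of height `1` and radius `δ` centred at `c`. -/
noncomputable def tent (c δ x : ℝ) : ℝ := max 0 (1 - |x - c| / δ)

theorem continuous_tent (c δ : ℝ) : Continuous (tent c δ) := by
  unfold tent; fun_prop

theorem tent_nonneg (c δ x : ℝ) : 0 ≤ tent c δ x := le_max_left _ _

theorem tent_self (c δ : ℝ) : tent c δ c = 1 := by simp [tent]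

theorem tent_le_one {δ : ℝ} (hδ : 0 < δ) (c x : ℝ) : tent c δ x ≤ 1 :=
  max_le zero_le_one (sub_le_self _ (by positivity))

theorem tent_eq_zero {c δ x : ℝ} (hδ : 0 < δ) (h : δ ≤ |x - c|) : tent c δ x = 0 :=
  max_eq_left (sub_nonpos.2 ((one_le_div hδ).2 h))

theorem integrable_tent {δ : ℝ} (hδ : 0 < δ) (c : ℝ) (ν : Measure ℝ) [IsFiniteMeasure ν] :
    Integrable (tent c δ) ν :=
  Integrable.of_bound (continuous_tent c δ).aestronglyMeasurable 1 <| .of_forall fun x => by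
    rw [Real.norm_of_nonneg (tent_nonneg c δ x)]
    exact tent_le_one hδ c x

theorem measureReal_singleton_le_integral_tent {δ : ℝ} (hδ : 0 < δ) (c : ℝ) (ν : Measure ℝ)
    [IsFiniteMeasure ν] : ν.real {c} ≤ ∫ x, tent c δ x ∂ν := by
  rw [← integral_indicator_one (measurableSet_singleton c)]
  refine integral_mono ((integrable_const (1 : ℝ)).indicator (measurableSet_singleton c))
    (integrable_tent hδ c ν) fun x => ?_
  by_cases hx : x = c
  · subst hx
    simp [tent_self]
  · simpa [hx] using tent_nonneg c δ x

/-- Let `I = [a,b]` be a compact interval, `(μ_n)` Borel probability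
measures on `I` converging weak-* to `μ`, and `c ∈ I` with `μ({c}) > 0`.  Let
`g : I → [-∞,∞)` be bounded above (by `M` on `I`), continuous on `I ∖ {c}`, with
`g(c) = -∞` and `g(x) → -∞` as `x → c`.  Then `∫ g dμ_n → -∞` (in the extended sense);
equivalently, since `g ≤ M` on `I`, `∫⁻ (M - g) dμ_n → ∞`. -/
theorem weak_star_atom_forces_divergence
    (a b : ℝ) (hab : a ≤ b)
    (μn : ℕ → Measure ℝ) (μ : Measure ℝ)
    (hμn_prob : ∀ n, IsProbabilityMeasure (μn n))
    (hμn_supp : ∀ n, μn n (Set.Icc a b)ᶜ = 0)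
    (hμ_prob : IsProbabilityMeasure μ) (hμ_supp : μ (Set.Icc a b)ᶜ = 0)
    (hweak : ∀ φ : ℝ → ℝ, Continuous φ →
      Tendsto (fun n => ∫ x, φ x ∂(μn n)) atTop (nhds (∫ x, φ x ∂μ)))
    (c : ℝ) (hc : c ∈ Set.Icc a b) (hatom : 0 < μ {c})
    (g : ℝ → EReal) (M : ℝ)
    (hgM : ∀ x ∈ Set.Icc a b, g x ≤ (M : EReal))
    (hg_cont : ContinuousOn g (Set.Icc a b \ {c}))
    (hg_c : g c = ⊥)
    (hg_tend : Tendsto g (nhdsWithin c (Set.Icc a b \ {c})) (nhds ⊥)) :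
    Tendsto (fun n => ∫⁻ x, erealToENNReal ((M : EReal) - g x) ∂(μn n)) atTop
      (nhds ⊤) := by
  rw [ENNReal.tendsto_nhds_top_iff_nat]
  intro L
  have hm : 0 < μ.real {c} := ENNReal.toReal_pos hatom.ne' (measure_ne_top _ _)
  set m := μ.real {c}
  set K : ℝ := 2 * (L + 1) / m with hK
  have hK0 : 0 ≤ K := by positivity
  have hev := hg_tend.eventually (eventually_lt_nhds (EReal.bot_lt_coe (M - K)))
  obtain ⟨δ, hδ, hball⟩ := Metric.mem_nhdsWithin_iff.1 hev
  have hle : ∀ x ∈ Icc a b, ENNReal.ofReal (K * tent c δ x) ≤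
      erealToENNReal ((M : EReal) - g x) := by
    intro x hx
    by_cases hd : |x - c| < δ
    · refine (ENNReal.ofReal_le_ofReal
        (mul_le_of_le_one_right hK0 (tent_le_one hδ c x))).trans
        (ofReal_le_erealToENNReal_sub ?_)
      by_cases hxc : x = c
      · rw [hxc, hg_c]
        exact EReal.bot_lt_coe _
      · exact hball ⟨by rwa [Metric.mem_ball, Real.dist_eq], hx, hxc⟩
    · simp [tent_eq_zero hδ (not_lt.1 hd)]
  have hlt : m / 2 < ∫ x, tent c δ x ∂μ :=
    (half_lt_self hm).trans_le (measureReal_singleton_le_integral_tent hδ c μ)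
  filter_upwards [(hweak _ (continuous_tent c δ)).eventually (eventually_gt_nhds hlt)] with n hn
  calc (L : ℝ≥0∞) = ENNReal.ofReal L := (ENNReal.ofReal_natCast L).symm
    _ < ENNReal.ofReal (K * ∫ x, tent c δ x ∂(μn n)) := by
      have hKm : K * (m / 2) = L + 1 := by rw [hK]; field_simp
      have hmul := mul_le_mul_of_nonneg_left hn.le hK0
      exact (ENNReal.ofReal_lt_ofReal_iff_of_nonneg L.cast_nonneg).2 (by linarith)
    _ = ∫⁻ x, ENNReal.ofReal (K * tent c δ x) ∂(μn n) := by
      rw [← integral_const_mul]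
      exact ofReal_integral_eq_lintegral_ofReal ((integrable_tent hδ c _).const_mul K)
        (.of_forall fun x => mul_nonneg hK0 (tent_nonneg c δ x))
    _ ≤ ∫⁻ x, erealToENNReal ((M : EReal) - g x) ∂(μn n) :=
      lintegral_mono_ae (mem_of_superset (mem_ae_iff.2 (hμn_supp n)) hle)
end

section
/- Let Θ ⊆ ℝ^d be open and T: Θ × [0,1] → ℝ, (θ,x) ↦ T_θ(x), be of class C³. Assume that for each θ ∈ Θ there is a unique c_θ ∈ (0,1) with T'_θ(c_θ) = 0 (where T'_θ denotes the derivative in x), that T'_θ(x) ≠ 0 for x ≠ c_θ, and that T''_θ(c_θ) ≠ 0 (quadratic critical point). Then for every θ ∈ Θ, ‖log|T'_θ| − log|T'_{θ'}|‖_{L¹([0,1])} → 0 as θ' → θ. -/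
open MeasureTheory Set Filter Topology
open scoped ENNReal NNReal

/-- The partial derivative in the real variable of a `C^(n+1)` function is `C^n`. -/
lemma contDiffOn_derivWithin_snd {E : Type*} [NormedAddCommGroup E] [NormedSpace ℝ E]
    {Θ : Set E} (hΘ : IsOpen Θ) {F : E → ℝ → ℝ} {m n : WithTop ℕ∞} (hmn : m + 1 ≤ n)
    (hF : ContDiffOn ℝ n (fun p : E × ℝ => F p.1 p.2) (Θ ×ˢ Icc (0 : ℝ) 1)) :
    ContDiffOn ℝ m (fun p : E × ℝ => derivWithin (F p.1) (Icc 0 1) p.2)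
      (Θ ×ˢ Icc (0 : ℝ) 1) := by
  have hI : UniqueDiffOn ℝ (Icc (0 : ℝ) 1) := uniqueDiffOn_Icc one_pos
  have hU : UniqueDiffOn ℝ (Θ ×ˢ Icc (0 : ℝ) 1) := hΘ.uniqueDiffOn.prod hI
  refine ((hF.fderivWithin hU hmn).clm_apply
    (contDiffOn_const (c := ((0 : E), (1 : ℝ))))).congr ?_
  rintro ⟨θ, x⟩ ⟨hθ, hx⟩
  have hn : n ≠ 0 := by
    rintro rfl
    simp at hmn
  have h1 := (hF.differentiableOn hn (θ, x) ⟨hθ, hx⟩).hasFDerivWithinAt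
  have h2 : HasDerivWithinAt (fun y : ℝ => (θ, y)) ((0 : E), (1 : ℝ)) (Icc 0 1) x :=
    (hasDerivWithinAt_const x _ θ).prodMk (hasDerivWithinAt_id x _)
  exact (h1.comp_hasDerivWithinAt x h2 fun y hy => ⟨hθ, hy⟩).derivWithin (hI x hx)

/-- A condition that holds eventually near each point of `{θ} × K`, relative to `s ×ˢ K`, holds
uniformly on `K`, for parameters in `s` near `θ`. -/
lemma IsCompact.eventually_forall_of_eventually_nhdsWithin {X Y : Type*} [TopologicalSpace X]
    [TopologicalSpace Y] {s : Set X} {K : Set Y} (hK : IsCompact K) {θ : X} {P : X → Y → Prop}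
    (h : ∀ y ∈ K, ∀ᶠ z in 𝓝[s ×ˢ K] (θ, y), P z.1 z.2) :
    ∀ᶠ η in 𝓝[s] θ, ∀ y ∈ K, P η y := by
  have := hK.eventually_forall_of_forall_eventually (x₀ := θ)
    (P := fun η y => η ∈ s → y ∈ K → P η y) (fun y hy => by
      filter_upwards [eventually_nhdsWithin_iff.1 (h y hy)] with z hz h1 h2
      exact hz ⟨h1, h2⟩)
  rw [eventually_nhdsWithin_iff]
  filter_upwards [this] with η hη hs y hy using hη y hy hs hy

/-- The zero of a continuous family of functions on `[0,1]` depends continuously on the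
parameter, if it is unique. -/
lemma tendsto_zero_of_unique {X : Type*} [TopologicalSpace X] {s : Set X} {g : X → ℝ → ℝ}
    (hg : ContinuousOn (fun p : X × ℝ => g p.1 p.2) (s ×ˢ Icc (0 : ℝ) 1)) {c : X → ℝ}
    (hc : ∀ η ∈ s, c η ∈ Icc (0 : ℝ) 1) (hc0 : ∀ η ∈ s, g η (c η) = 0)
    {θ : X} (hθ : θ ∈ s) (hu : ∀ x ∈ Icc (0 : ℝ) 1, x ≠ c θ → g θ x ≠ 0) :
    Tendsto c (𝓝[s] θ) (𝓝 (c θ)) := by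
  refine Metric.tendsto_nhds.2 fun ε hε => ?_
  have hK : IsCompact (Icc (0 : ℝ) 1 \ Metric.ball (c θ) ε) :=
    isCompact_Icc.diff Metric.isOpen_ball
  have := hK.eventually_forall_of_eventually_nhdsWithin (s := s) (θ := θ)
    (P := fun η x => g η x ≠ 0) fun x hx => by
      have hne : x ≠ c θ := fun h => hx.2 (h ▸ Metric.mem_ball_self hε)
      exact ((hg (θ, x) ⟨hθ, hx.1⟩).mono (prod_mono_right sdiff_subset)).eventually_ne
        (hu x hx.1 hne)
  filter_upwards [this, self_mem_nhdsWithin] with η hη hs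
  by_contra hcon
  exact hη (c η) ⟨hc η hs, hcon⟩ (hc0 η hs)

/-- Near a parameter with a simple zero, `g` is bounded below by a fixed multiple of the distance
to its zero. -/
lemma exists_eventually_mul_abs_sub_le {X : Type*} [TopologicalSpace X] {s : Set X}
    {g h : X → ℝ → ℝ}
    (hg : ContinuousOn (fun p : X × ℝ => g p.1 p.2) (s ×ˢ Icc (0 : ℝ) 1))
    (hh : ContinuousOn (fun p : X × ℝ => h p.1 p.2) (s ×ˢ Icc (0 : ℝ) 1))
    (hgh : ∀ η ∈ s, ∀ x ∈ Icc (0 : ℝ) 1, HasDerivWithinAt (g η) (h η x) (Icc 0 1) x) {c : X → ℝ}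
    (hc : ∀ η ∈ s, c η ∈ Icc (0 : ℝ) 1) (hc0 : ∀ η ∈ s, g η (c η) = 0)
    {θ : X} (hθ : θ ∈ s) (hu : ∀ x ∈ Icc (0 : ℝ) 1, x ≠ c θ → g θ x ≠ 0)
    (hq : h θ (c θ) ≠ 0) :
    ∃ k > 0, ∀ᶠ η in 𝓝[s] θ, ∀ x ∈ Icc (0 : ℝ) 1, k * |x - c η| ≤ |g η x| := by
  set a := h θ (c θ) with ha
  have ha0 : 0 < |a| := abs_pos.2 hq
  have hlim := tendsto_zero_of_unique hg hc hc0 hθ hu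
  have hnear : ∀ᶠ p : X × ℝ in 𝓝[s] θ ×ˢ 𝓝[Icc (0 : ℝ) 1] (c θ), |h p.1 p.2 - a| ≤ |a| / 2 := by
    rw [← nhdsWithin_prod_eq]
    have := Metric.tendsto_nhds.1 (hh (θ, c θ) ⟨hθ, hc θ hθ⟩) (|a| / 2) (by positivity)
    filter_upwards [this] with p hp
    exact le_of_lt hp
  obtain ⟨pa, hpa, pb, hpb, hab⟩ := eventually_prod_iff.1 hnear
  obtain ⟨δ, hδ, hball⟩ := Metric.mem_nhdsWithin_iff.1 hpb
  have hK : IsCompact (Icc (0 : ℝ) 1 \ Metric.ball (c θ) δ) :=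
    isCompact_Icc.diff Metric.isOpen_ball
  have hgθ : ContinuousOn (fun x => |g θ x|) (Icc (0 : ℝ) 1 \ Metric.ball (c θ) δ) := by
    intro x hx
    exact ((hgh θ hθ x hx.1).continuousWithinAt.mono sdiff_subset).abs
  have hpos : ∀ x ∈ Icc (0 : ℝ) 1 \ Metric.ball (c θ) δ, 0 < |g θ x| := fun x hx =>
    abs_pos.2 (hu x hx.1 fun e => hx.2 (e ▸ Metric.mem_ball_self hδ))
  obtain ⟨m, hm0, hm⟩ : ∃ m > 0, ∀ x ∈ Icc (0 : ℝ) 1 \ Metric.ball (c θ) δ, m < |g θ x| :=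
    hK.exists_forall_le' hgθ hpos |>.imp' (· / 2) fun m hm =>
      ⟨half_pos hm.1, fun x hx => (half_lt_self hm.1).trans_le (hm.2 x hx)⟩
  have hfar := hK.eventually_forall_of_eventually_nhdsWithin (s := s) (θ := θ)
    (P := fun η x => m < |g η x|) fun x hx =>
      ((hg (θ, x) ⟨hθ, hx.1⟩).mono (prod_mono_right sdiff_subset)).abs.eventually_const_lt (hm x hx)
  refine ⟨min m (|a| / 2), lt_min hm0 (by positivity), ?_⟩
  filter_upwards [hpa, hfar, self_mem_nhdsWithin, hlim (Metric.ball_mem_nhds _ hδ)]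
    with η hη hηfar hs hcη x hx
  by_cases hxb : x ∈ Metric.ball (c θ) δ
  · have hconv : Convex ℝ (Icc (0 : ℝ) 1 ∩ Metric.ball (c θ) δ) :=
      (convex_Icc 0 1).inter (convex_ball _ _)
    have key := hconv.norm_image_sub_le_of_norm_hasDerivWithin_le
      (f := fun y => g η y - a * y) (f' := fun y => h η y - a) (C := |a| / 2)
      (fun y hy => (((hgh η hs y hy.1).mono inter_subset_left).sub
        (((hasDerivWithinAt_id y _).const_mul a))).congr_deriv (by simp))
      (fun y hy => hab hη (hball ⟨hy.2, hy.1⟩)) ⟨hc η hs, hcη⟩ ⟨hx, hxb⟩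
    rw [hc0 η hs, Real.norm_eq_abs, Real.norm_eq_abs] at key
    have e : a * (x - c η) = g η x - (g η x - a * x - (0 - a * c η)) := by ring
    have h1 : |a| * |x - c η| ≤ |g η x| + |a| / 2 * |x - c η| := by
      rw [← abs_mul, e]
      exact (abs_sub _ _).trans (by gcongr)
    calc _ ≤ |a| / 2 * |x - c η| := by gcongr; exact min_le_right _ _
      _ ≤ _ := by linarith
  · have h1 := hηfar x ⟨hx, hxb⟩
    have h2 : |x - c η| ≤ 1 := by
      have := hc η hs
      rw [abs_le]
      constructor <;> linarith [hx.1, hx.2, this.1, this.2]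
    calc _ ≤ m * 1 := by gcongr; exact min_le_left _ _
      _ ≤ _ := by linarith

lemma exists_eventually_abs_le {X : Type*} [TopologicalSpace X] {s : Set X} {g : X → ℝ → ℝ}
    (hg : ContinuousOn (fun p : X × ℝ => g p.1 p.2) (s ×ˢ Icc (0 : ℝ) 1)) {θ : X} (hθ : θ ∈ s) :
    ∃ M > 0, ∀ᶠ η in 𝓝[s] θ, ∀ x ∈ Icc (0 : ℝ) 1, |g η x| ≤ M := by
  have hgθ : ContinuousOn (g θ) (Icc (0 : ℝ) 1) :=
    hg.comp (f := fun x => (θ, x)) (by fun_prop) fun x hx => ⟨hθ, hx⟩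
  obtain ⟨C, hC⟩ := isCompact_Icc.exists_bound_of_continuousOn hgθ
  have hC0 : 0 ≤ C := (norm_nonneg _).trans (hC 0 (by simp))
  refine ⟨C + 1, by positivity, ?_⟩
  refine isCompact_Icc.eventually_forall_of_eventually_nhdsWithin fun x hx => ?_
  have hx' : |g θ x| < C + 1 := (hC x hx).trans_lt (lt_add_one C)
  filter_upwards [(hg (θ, x) ⟨hθ, hx⟩).abs.eventually_lt_const hx'] with z hz using hz.le

lemma integrableOn_log_sub (c : ℝ) :
    IntegrableOn (fun x => Real.log (x - c)) (Icc (0 : ℝ) 1) := by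
  rw [integrableOn_Icc_iff_integrableOn_Ioc,
    ← intervalIntegrable_iff_integrableOn_Ioc_of_le zero_le_one]
  have := (intervalIntegral.intervalIntegrable_log' (a := 0 - c) (b := 1 - c)).comp_sub_right c
  simpa using this

lemma integral_log_sub (c : ℝ) :
    ∫ x in Icc (0 : ℝ) 1, Real.log (x - c) =
      (1 - c) * Real.log (1 - c) - (0 - c) * Real.log (0 - c) - (1 - c) + (0 - c) := by
  rw [integral_Icc_eq_integral_Ioc, ← intervalIntegral.integral_of_le zero_le_one,
    intervalIntegral.integral_comp_sub_right (fun x => Real.log x) c, integral_log]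

lemma log_sub_nonpos {x c : ℝ} (hx : x ∈ Icc (0 : ℝ) 1) (hc : c ∈ Icc (0 : ℝ) 1) :
    Real.log (x - c) ≤ 0 := by
  rw [← Real.log_abs]
  refine Real.log_nonpos (abs_nonneg _) ?_
  rw [abs_le]
  constructor <;> linarith [hx.1, hx.2, hc.1, hc.2]

/-- Translates of the logarithmic singularity converge in `L¹([0,1])`. -/
lemma tendsto_integral_abs_log_sub {X : Type*} {l : Filter X} [l.IsCountablyGenerated]
    {c : X → ℝ} {c₀ : ℝ} (hc₀ : c₀ ∈ Icc (0 : ℝ) 1) (hc : ∀ᶠ η in l, c η ∈ Icc (0 : ℝ) 1)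
    (hlim : Tendsto c l (𝓝 c₀)) :
    Tendsto (fun η => ∫ x in Icc (0 : ℝ) 1, |Real.log (x - c η) - Real.log (x - c₀)|) l (𝓝 0) := by
  have hmax : Tendsto
      (fun η => ∫ x in Icc (0 : ℝ) 1, max (Real.log (x - c η)) (Real.log (x - c₀))) l
      (𝓝 (∫ x in Icc (0 : ℝ) 1, Real.log (x - c₀))) := by
    refine tendsto_integral_filter_of_dominated_convergence
      (fun x => |Real.log (x - c₀)|) (.of_forall fun η => ?_) ?_ (integrableOn_log_sub c₀).abs ?_
    · exact ((integrableOn_log_sub (c η)).sup (integrableOn_log_sub c₀)).aestronglyMeasurable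
    · filter_upwards [hc] with η hη
      filter_upwards [ae_restrict_mem measurableSet_Icc] with x hx
      have h1 := log_sub_nonpos hx hη
      have h2 := log_sub_nonpos hx hc₀
      rw [Real.norm_eq_abs, abs_of_nonpos (max_le h1 h2), abs_of_nonpos h2]
      exact neg_le_neg (le_max_right _ _)
    · filter_upwards [Measure.ae_ne (volume.restrict (Icc (0 : ℝ) 1)) c₀] with x hx
      have h1 : Tendsto (fun η => Real.log (x - c η)) l (𝓝 (Real.log (x - c₀))) :=
        (hlim.const_sub x).log (sub_ne_zero.2 hx)
      simpa using h1.max (tendsto_const_nhds (x := Real.log (x - c₀)))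
  have hint : Tendsto (fun η => ∫ x in Icc (0 : ℝ) 1, Real.log (x - c η)) l
      (𝓝 (∫ x in Icc (0 : ℝ) 1, Real.log (x - c₀))) := by
    simp only [integral_log_sub]
    have hcont : Continuous fun c : ℝ =>
        (1 - c) * Real.log (1 - c) - (0 - c) * Real.log (0 - c) - (1 - c) + (0 - c) := by
      have h := Real.continuous_mul_log
      have h1 := h.comp (by fun_prop : Continuous fun c : ℝ => 1 - c)
      have h0 := h.comp (by fun_prop : Continuous fun c : ℝ => 0 - c)
      exact ((h1.sub h0).sub (by fun_prop)).add (by fun_prop)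
    exact (hcont.tendsto c₀).comp hlim
  have hsum := ((hmax.const_mul 2).sub hint).sub
    (tendsto_const_nhds (x := ∫ x in Icc (0 : ℝ) 1, Real.log (x - c₀)))
  convert hsum using 2 with η
  · have i1 := integrableOn_log_sub (c η)
    have i2 := integrableOn_log_sub c₀
    have i3 : IntegrableOn (fun x => max (Real.log (x - c η)) (Real.log (x - c₀)))
      (Icc (0 : ℝ) 1) := i1.sup i2
    have i4 : IntegrableOn (fun x => 2 * max (Real.log (x - c η)) (Real.log (x - c₀)) -
      Real.log (x - c η)) (Icc (0 : ℝ) 1) := (i3.const_mul 2).sub i1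
    rw [← integral_const_mul, ← integral_sub (i3.const_mul 2) i1, ← integral_sub i4 i2]
    congr 1 with x
    rcases le_total (Real.log (x - c η)) (Real.log (x - c₀)) with h | h
    · rw [max_eq_right h, abs_of_nonpos (sub_nonpos.2 h)]; ring
    · rw [max_eq_left h, abs_of_nonneg (sub_nonneg.2 h)]; ring
  · ring

lemma abs_log_abs_le {k M x c y : ℝ} (hk : 0 < k) (hlow : k * |x - c| ≤ |y|) (hup : |y| ≤ M)
    (h0 : x = c → y = 0) (hx : x ∈ Icc (0 : ℝ) 1) (hc : c ∈ Icc (0 : ℝ) 1) :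
    |Real.log (|y|)| ≤ |Real.log k| + |Real.log M| - Real.log (x - c) := by
  have hU := log_sub_nonpos hx hc
  have := abs_nonneg (Real.log k)
  have := abs_nonneg (Real.log M)
  rcases eq_or_ne x c with h | h
  · rw [h0 h]
    simp only [abs_zero, Real.log_zero]
    linarith
  · have hxc : 0 < |x - c| := abs_pos.2 (sub_ne_zero.2 h)
    have h1 := Real.log_le_log (mul_pos hk hxc) hlow
    have h2 := Real.log_le_log ((mul_pos hk hxc).trans_le hlow) hup
    rw [Real.log_mul hk.ne' hxc.ne', Real.log_abs (x - c)] at h1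
    rw [abs_le]
    constructor <;> linarith [neg_abs_le (Real.log k), le_abs_self (Real.log M)]

/-- `L¹` continuity of `log |g|` for a continuous family with a unique, simple zero. -/
lemma tendsto_integral_abs_log_abs_sub {X : Type*} [TopologicalSpace X]
    [FirstCountableTopology X] {s : Set X} {g h : X → ℝ → ℝ}
    (hg : ContinuousOn (fun p : X × ℝ => g p.1 p.2) (s ×ˢ Icc (0 : ℝ) 1))
    (hh : ContinuousOn (fun p : X × ℝ => h p.1 p.2) (s ×ˢ Icc (0 : ℝ) 1))
    (hgh : ∀ η ∈ s, ∀ x ∈ Icc (0 : ℝ) 1, HasDerivWithinAt (g η) (h η x) (Icc 0 1) x) {c : X → ℝ}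
    (hc : ∀ η ∈ s, c η ∈ Icc (0 : ℝ) 1) (hc0 : ∀ η ∈ s, g η (c η) = 0)
    {θ : X} (hθ : θ ∈ s) (hu : ∀ x ∈ Icc (0 : ℝ) 1, x ≠ c θ → g θ x ≠ 0)
    (hq : h θ (c θ) ≠ 0) :
    Tendsto (fun η => ∫ x in Icc (0 : ℝ) 1, |Real.log |g θ x| - Real.log (|g η x|)|)
      (𝓝[s] θ) (𝓝 0) := by
  have hcs : ∀ᶠ η in 𝓝[s] θ, c η ∈ Icc (0 : ℝ) 1 := by
    filter_upwards [self_mem_nhdsWithin] with η hη using hc η hη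
  have hU := tendsto_integral_abs_log_sub (hc θ hθ) hcs (tendsto_zero_of_unique hg hc hc0 hθ hu)
  obtain ⟨k, hk, hlow⟩ := exists_eventually_mul_abs_sub_le hg hh hgh hc hc0 hθ hu hq
  obtain ⟨M, -, hup⟩ := exists_eventually_abs_le hg hθ
  set A := |Real.log k| + |Real.log M|
  have hbound : ∀ᶠ η in 𝓝[s] θ, ∀ x ∈ Icc (0 : ℝ) 1,
      |Real.log (|g η x|)| ≤ A - Real.log (x - c η) := by
    filter_upwards [hlow, hup, self_mem_nhdsWithin] with η h1 h2 hs x hx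
    exact abs_log_abs_le hk (h1 x hx) (h2 x hx) (fun e => e ▸ hc0 η hs) hx (hc η hs)
  have hboundθ := hbound.self_of_nhdsWithin hθ
  have hmeas : ∀ η ∈ s, AEStronglyMeasurable (fun x => Real.log |g η x|)
      (volume.restrict (Icc (0 : ℝ) 1)) := fun η hη => by
    have : ContinuousOn (g η) (Icc (0 : ℝ) 1) := fun x hx => (hgh η hη x hx).continuousWithinAt
    simp only [Real.log_abs]
    exact (Real.measurable_log.comp_aemeasurable
      (this.aemeasurable measurableSet_Icc)).aestronglyMeasurable
  have hBint : IntegrableOn (fun x => 2 * (A - Real.log (x - c θ))) (Icc (0 : ℝ) 1) :=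
    ((integrableOn_const (by simp)).sub (integrableOn_log_sub (c θ))).const_mul 2
  have hB0 : ∀ x ∈ Icc (0 : ℝ) 1, 0 ≤ 2 * (A - Real.log (x - c θ)) := fun x hx =>
    mul_nonneg zero_le_two ((abs_nonneg _).trans (hboundθ x hx))
  have hmeasmin : ∀ η ∈ s, AEStronglyMeasurable (fun x =>
      min |Real.log |g θ x| - Real.log (|g η x|)| (2 * (A - Real.log (x - c θ))))
      (volume.restrict (Icc (0 : ℝ) 1)) := fun η hη =>
    ((hmeas θ hθ).sub (hmeas η hη)).norm.inf hBint.aestronglyMeasurable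
  have hminle : ∀ η, ∀ x ∈ Icc (0 : ℝ) 1,
      ‖min |Real.log |g θ x| - Real.log (|g η x|)| (2 * (A - Real.log (x - c θ)))‖ ≤
        2 * (A - Real.log (x - c θ)) := fun η x hx => by
    rw [Real.norm_of_nonneg (le_min (abs_nonneg _) (hB0 x hx))]
    exact min_le_right _ _
  have hmin : Tendsto (fun η => ∫ x in Icc (0 : ℝ) 1,
      min |Real.log |g θ x| - Real.log (|g η x|)| (2 * (A - Real.log (x - c θ))))
      (𝓝[s] θ) (𝓝 (∫ _ in Icc (0 : ℝ) 1, (0 : ℝ))) := by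
    refine tendsto_integral_filter_of_dominated_convergence
      (fun x => 2 * (A - Real.log (x - c θ))) ?_ (.of_forall fun η => ?_) hBint ?_
    · filter_upwards [self_mem_nhdsWithin] with η hη using hmeasmin η hη
    · filter_upwards [ae_restrict_mem measurableSet_Icc] with x hx using hminle η x hx
    · filter_upwards [ae_restrict_mem measurableSet_Icc,
        Measure.ae_ne (volume.restrict (Icc (0 : ℝ) 1)) (c θ)] with x hx hne
      have h1 : Tendsto (fun η => g η x) (𝓝[s] θ) (𝓝 (g θ x)) :=
        (hg.comp (f := fun η => (η, x)) (by fun_prop) fun η hη => ⟨hη, hx⟩) θ hθ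
      have h2 : Tendsto (fun η => Real.log |g η x|) (𝓝[s] θ) (𝓝 (Real.log |g θ x|)) :=
        h1.abs.log (abs_pos.2 (hu x hx hne)).ne'
      have h3 := (h2.const_sub (Real.log |g θ x|)).abs.min
        (tendsto_const_nhds (x := 2 * (A - Real.log (x - c θ))))
      rwa [sub_self, abs_zero, min_eq_left (hB0 x hx)] at h3
  have htot := hmin.add hU
  rw [integral_zero, add_zero] at htot
  refine squeeze_zero' (.of_forall fun η => integral_nonneg fun x => abs_nonneg _) ?_ htot
  filter_upwards [hbound, self_mem_nhdsWithin] with η hη hs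
  have hi1 : IntegrableOn (fun x =>
      min |Real.log |g θ x| - Real.log (|g η x|)| (2 * (A - Real.log (x - c θ))))
      (Icc (0 : ℝ) 1) := by
    refine Integrable.mono' hBint (hmeasmin η hs) ?_
    filter_upwards [ae_restrict_mem measurableSet_Icc] with x hx using hminle η x hx
  have hi2 : IntegrableOn (fun x => |Real.log (x - c η) - Real.log (x - c θ)|) (Icc (0 : ℝ) 1) :=
    ((integrableOn_log_sub (c η)).sub (integrableOn_log_sub (c θ))).abs
  rw [← integral_add hi1 hi2]
  refine integral_mono_of_nonneg (.of_forall fun x => abs_nonneg _) (hi1.add hi2) ?_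
  filter_upwards [ae_restrict_mem measurableSet_Icc] with x hx
  have h1 := hη x hx
  have h2 := hboundθ x hx
  have h3 := abs_sub (Real.log |g θ x|) (Real.log (|g η x|))
  have h4 := neg_abs_le (Real.log (x - c η) - Real.log (x - c θ))
  rcases min_cases |Real.log |g θ x| - Real.log (|g η x|)| (2 * (A - Real.log (x - c θ)))
    with ⟨h, -⟩ | ⟨h, -⟩ <;> rw [h]
  · linarith [abs_nonneg (Real.log (x - c η) - Real.log (x - c θ))]
  · linarith

/-- Let `Θ ⊆ ℝ^d` be open and `T : Θ × [0,1] → ℝ`, `(θ,x) ↦ T_θ(x)`, of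
class `C³`.  Assume for each `θ ∈ Θ` there is a unique `c_θ ∈ (0,1)` with `T'_θ(c_θ) = 0`
(derivative in `x`), `T'_θ(x) ≠ 0` for `x ≠ c_θ`, and `T''_θ(c_θ) ≠ 0`.  Then for every
`θ ∈ Θ`, `‖log|T'_θ| - log|T'_{θ'}|‖_{L¹([0,1])} → 0` as `θ' → θ` in `Θ`. -/
theorem log_deriv_L1_continuity_in_parameter
    (d : ℕ) (Θ : Set (Fin d → ℝ)) (hΘ : IsOpen Θ)
    (T : (Fin d → ℝ) → ℝ → ℝ)
    (hT : ContDiffOn ℝ 3 (fun p : (Fin d → ℝ) × ℝ => T p.1 p.2)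
      (Θ ×ˢ Set.Icc (0:ℝ) 1))
    (cmap : (Fin d → ℝ) → ℝ)
    (hc_mem : ∀ θ ∈ Θ, cmap θ ∈ Set.Ioo (0:ℝ) 1)
    (hc_crit : ∀ θ ∈ Θ, derivWithin (T θ) (Set.Icc (0:ℝ) 1) (cmap θ) = 0)
    (hc_uniq : ∀ θ ∈ Θ, ∀ x ∈ Set.Icc (0:ℝ) 1, x ≠ cmap θ →
      derivWithin (T θ) (Set.Icc (0:ℝ) 1) x ≠ 0)
    (hc_quad : ∀ θ ∈ Θ,
      derivWithin (derivWithin (T θ) (Set.Icc (0:ℝ) 1)) (Set.Icc (0:ℝ) 1) (cmap θ) ≠ 0) :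
    ∀ θ ∈ Θ, Tendsto
      (fun θ' => ∫ x in Set.Icc (0:ℝ) 1,
        |Real.log (abs (derivWithin (T θ) (Set.Icc (0:ℝ) 1) x))
          - Real.log (abs (derivWithin (T θ') (Set.Icc (0:ℝ) 1) x))|)
      (nhdsWithin θ Θ) (nhds 0) := by
  intro θ hθ
  have hg := contDiffOn_derivWithin_snd (m := 2) hΘ (by norm_num) hT
  have hh := contDiffOn_derivWithin_snd (m := 1) (n := 2)
    (F := fun η => derivWithin (T η) (Icc 0 1)) hΘ (by norm_num) hg
  refine tendsto_integral_abs_log_abs_sub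
    (g := fun η => derivWithin (T η) (Icc 0 1))
    (h := fun η => derivWithin (derivWithin (T η) (Icc 0 1)) (Icc 0 1)) hg.continuousOn hh.continuousOn
    (fun η hη x hx => ?_) (fun η hη => Ioo_subset_Icc_self (hc_mem η hη)) hc_crit hθ
    (hc_uniq θ hθ) (hc_quad θ hθ)
  exact ((hg.comp (f := fun y => (η, y)) (by fun_prop) fun y hy => ⟨hη, hy⟩).differentiableOn
    two_ne_zero x hx).hasDerivWithinAt
end
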